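/- arXiv:1803.02658 — 2 statements merged into one kernel-verified Lean document; each statement's English description precedes it below -/
import Mathlib

section
/- Let N ≥ 2, let ω = B₁(0) ⊂ ℝ^N be the open unit ball, let K ≥ 0 and p > N. There exists C > 0, depending only on N, K and p, such that: for every continuous a : ω → ℝ with 0 ≤ a ≤ K, every continuous nonnegative g : ω → ℝ with g ∈ L^p(ω), and every function u ∈ C²(ω) ∩ C(cl(ω)) with u ≤ 0 on ∂ω and −Δu(x) + a(x)u(x) ≤ g(x) for all x ∈ ω, one has u(x) ≤ C·‖g‖_{L^p(ω)}·(1−|x|) for all x ∈ ω. -/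
open MeasureTheory Metric Set

/-- The Laplacian of a real-valued function on `ℝ^N`, as the sum of second
partial derivatives in the coordinate directions. -/
noncomputable def lap {N : ℕ} (u : EuclideanSpace ℝ (Fin N) → ℝ)
    (x : EuclideanSpace ℝ (Fin N)) : ℝ :=
  ∑ i : Fin N, fderiv ℝ (fun y => fderiv ℝ u y (EuclideanSpace.single i 1)) x
    (EuclideanSpace.single i 1)

open Filter Topology

section SecondDerivative

/-- `f` is differentiable near `t` and `D` is the derivative at `t` of its derivative. -/
def HasSecondDerivAt (f : ℝ → ℝ) (D t : ℝ) : Prop :=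
  ∃ f' : ℝ → ℝ, (∀ᶠ s in 𝓝 t, HasDerivAt f (f' s) s) ∧ HasDerivAt f' D t

theorem HasSecondDerivAt.add {f g : ℝ → ℝ} {D D' t : ℝ} (hf : HasSecondDerivAt f D t)
    (hg : HasSecondDerivAt g D' t) : HasSecondDerivAt (fun s => f s + g s) (D + D') t := by
  obtain ⟨f', h1, h2⟩ := hf
  obtain ⟨g', h3, h4⟩ := hg
  refine ⟨fun s => f' s + g' s, ?_, h2.add h4⟩
  filter_upwards [h1, h3] with s h h' using h.add h'

theorem HasSecondDerivAt.const_mul {f : ℝ → ℝ} {D t : ℝ} (c : ℝ) (hf : HasSecondDerivAt f D t) :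
    HasSecondDerivAt (fun s => c * f s) (c * D) t := by
  obtain ⟨f', h1, h2⟩ := hf
  refine ⟨fun s => c * f' s, ?_, h2.const_mul c⟩
  filter_upwards [h1] with s h using h.const_mul c

theorem HasSecondDerivAt.nonpos_of_isLocalMax {f : ℝ → ℝ} {D t : ℝ}
    (hf : HasSecondDerivAt f D t) (hmax : IsLocalMax f t) : D ≤ 0 := by
  obtain ⟨f', h1, h2⟩ := hf
  by_contra! hD
  have hderiv : deriv f =ᶠ[𝓝 t] f' := h1.mono fun s hs => hs.deriv
  have hdd : deriv (deriv f) t = D := by rw [hderiv.deriv_eq, h2.deriv]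
  have hmin : IsLocalMin f t := isLocalMin_of_deriv_deriv_pos (by rw [hdd]; exact hD)
    hmax.deriv_eq_zero h1.self_of_nhds.continuousAt
  have hconst : f =ᶠ[𝓝 t] fun _ => f t := by
    filter_upwards [hmin, hmax] with s h h' using le_antisymm h' h
  have hzero : deriv f =ᶠ[𝓝 t] fun _ => 0 := by
    simpa using hconst.deriv
  rw [hzero.deriv_eq] at hdd
  simp at hdd
  exact hD.ne hdd

end SecondDerivative

section Primitive

/-- A primitive of `s ↦ -s ^ (-m)` on the positive half-line. -/
noncomputable def negPowPrimitive (m s : ℝ) : ℝ := ∫ τ in (1 : ℝ)..s, -τ ^ (-m)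

theorem hasDerivAt_negPowPrimitive (m : ℝ) {s : ℝ} (hs : 0 < s) :
    HasDerivAt (negPowPrimitive m) (-s ^ (-m)) s := by
  have hcont : ContinuousOn (fun τ : ℝ => -τ ^ (-m)) (Ioi 0) := fun τ hτ =>
    ((Real.continuousAt_rpow_const τ (-m) (Or.inl (ne_of_gt hτ))).neg).continuousWithinAt
  refine intervalIntegral.integral_hasDerivAt_right ?_ ?_ ?_
  · refine (hcont.mono fun τ hτ => ?_).intervalIntegrable
    exact lt_of_lt_of_le (lt_min one_pos hs) hτ.1
  · exact hcont.stronglyMeasurableAtFilter isOpen_Ioi s hs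
  · exact hcont.continuousAt (Ioi_mem_nhds hs)

theorem negPowPrimitive_anti (m : ℝ) {a b : ℝ} (ha : 0 < a) (hab : a ≤ b) :
    negPowPrimitive m b ≤ negPowPrimitive m a := by
  have hpos : ∀ s ∈ Icc a b, 0 < s := fun s hs => ha.trans_le hs.1
  refine antitoneOn_of_deriv_nonpos (convex_Icc a b)
    (fun s hs => (hasDerivAt_negPowPrimitive m (hpos s hs)).continuousAt.continuousWithinAt)
    (fun s hs => (hasDerivAt_negPowPrimitive m
      (hpos s (interior_subset hs))).differentiableAt.differentiableWithinAt)
    (fun s hs => ?_) (left_mem_Icc.2 hab) (right_mem_Icc.2 hab) hab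
  rw [(hasDerivAt_negPowPrimitive m (hpos s (interior_subset hs))).deriv]
  exact neg_nonpos.2 (Real.rpow_nonneg (hpos s (interior_subset hs)).le _)

theorem negPowPrimitive_sub_le {m : ℝ} (hm : 1 / 2 ≤ m) {a b : ℝ} (ha : 0 < a) (hab : a ≤ b) :
    negPowPrimitive m a - negPowPrimitive m b ≤ 2 * (b - a) / √b * a ^ (-(m - 1 / 2)) := by
  set c := a ^ (-(m - 1 / 2)) with hc
  have hc0 : 0 ≤ c := Real.rpow_nonneg ha.le _
  have hpos : ∀ s ∈ Icc a b, 0 < s := fun s hs => ha.trans_le hs.1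
  have hd : ∀ s ∈ Icc a b, HasDerivAt (fun s => negPowPrimitive m s + 2 * √s * c)
      (-s ^ (-m) + 2 * (1 / (2 * √s)) * c) s := fun s hs =>
    (hasDerivAt_negPowPrimitive m (hpos s hs)).add
      (((Real.hasDerivAt_sqrt (hpos s hs).ne').const_mul 2).mul_const c)
  have hmono := monotoneOn_of_deriv_nonneg (convex_Icc a b)
    (fun s hs => (hd s hs).continuousAt.continuousWithinAt)
    (fun s hs => (hd s (interior_subset hs)).differentiableAt.differentiableWithinAt)
    (fun s hs => by
      rw [(hd s (interior_subset hs)).deriv]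
      have hs' := interior_subset hs
      have hs0 := hpos s hs'
      have h1 : s ^ (-m) = s ^ (-(m - 1 / 2)) * (1 / √s) := by
        rw [Real.sqrt_eq_rpow, one_div (s ^ (1 / 2 : ℝ)), ← Real.rpow_neg hs0.le,
          ← Real.rpow_add hs0]
        congr 1
        ring
      have h2 : s ^ (-(m - 1 / 2)) ≤ c :=
        Real.rpow_le_rpow_of_nonpos ha hs'.1 (by linarith)
      have h3 : 2 * (1 / (2 * √s)) * c = c * (1 / √s) := by
        have := (Real.sqrt_pos.2 hs0).ne'
        field_simp
      rw [h1, h3]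
      have h4 : 0 ≤ 1 / √s := by positivity
      nlinarith)
    (left_mem_Icc.2 hab) (right_mem_Icc.2 hab) hab
  have hb0 : 0 < √b := Real.sqrt_pos.2 (ha.trans_le hab)
  have ha0 : 0 < √a := Real.sqrt_pos.2 ha
  have hsq : 2 * (√b - √a) ≤ 2 * (b - a) / √b := by
    rw [le_div_iff₀ hb0]
    have h1 := Real.sq_sqrt ha.le
    have h2 := Real.sq_sqrt (ha.le.trans hab)
    have h3 : √a ≤ √b := Real.sqrt_le_sqrt hab
    nlinarith
  have := mul_le_mul_of_nonneg_right hsq hc0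
  simp only at hmono
  linarith

theorem hasDerivAt_negPowPrimitive_comp (m : ℝ) {P : ℝ → ℝ} {P' t : ℝ} (hP : HasDerivAt P P' t)
    (h0 : 0 < P t) :
    HasDerivAt (fun s => negPowPrimitive m (P s)) (-(P t ^ (-m) * P')) t := by
  have := (hasDerivAt_negPowPrimitive m h0).comp t hP
  convert! this using 1
  ring

theorem hasDerivAt_neg_rpow_mul (m : ℝ) {P P' : ℝ → ℝ} {P'' t : ℝ} (hP : HasDerivAt P (P' t) t)
    (hP' : HasDerivAt P' P'' t) (h0 : 0 < P t) :
    HasDerivAt (fun s => -(P s ^ (-m) * P' s))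
      (m * P t ^ (-m - 1) * P' t ^ 2 - P t ^ (-m) * P'') t := by
  have := ((hP.rpow_const (p := -m) (Or.inl h0.ne')).mul hP').neg
  convert! this using 1
  ring

end Primitive

section ParametricIntegral

variable {X Y : Type*} [TopologicalSpace X] [TopologicalSpace Y] {T : Set Y}

theorem exists_bound_near_of_continuous [WeaklyLocallyCompactSpace X] (hT : IsCompact T)
    {H : X → Y → ℝ} (hH : Continuous fun z : X × Y => H z.1 z.2) (x : X) :
    ∃ s ∈ 𝓝 x, ∃ M : ℝ, ∀ x' ∈ s, ∀ y ∈ T, ‖H x' y‖ ≤ M := by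
  obtain ⟨s, hs, hxs⟩ := exists_compact_mem_nhds x
  obtain ⟨M, hM⟩ := (hs.prod hT).exists_bound_of_continuousOn hH.continuousOn
  exact ⟨s, hxs, M, fun x' hx' y hy => hM (x', y) ⟨hx', hy⟩⟩

variable [MeasurableSpace Y] [OpensMeasurableSpace Y] {μ : Measure Y} {g : Y → ℝ}

theorem integrable_continuous_mul (hT : IsCompact T) (hμ : ∀ᵐ y ∂μ, y ∈ T) (hg : Integrable g μ)
    {h : Y → ℝ} (hh : Continuous h) : Integrable (fun y => h y * g y) μ := by
  obtain ⟨M, hM⟩ := hT.exists_bound_of_continuousOn hh.continuousOn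
  exact hg.bdd_mul hh.aestronglyMeasurable (hμ.mono fun y hy => hM y hy)

theorem continuous_integral_mul [WeaklyLocallyCompactSpace X] [FirstCountableTopology X]
    (hT : IsCompact T) (hμ : ∀ᵐ y ∂μ, y ∈ T) (hg : Integrable g μ)
    {H : X → Y → ℝ} (hH : Continuous fun z : X × Y => H z.1 z.2) :
    Continuous fun x => ∫ y, H x y * g y ∂μ := by
  refine continuous_iff_continuousAt.2 fun x => ?_
  obtain ⟨s, hs, M, hM⟩ := exists_bound_near_of_continuous hT hH x
  refine continuousAt_of_dominated (bound := fun y => M * ‖g y‖)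
    (Filter.Eventually.of_forall fun x' => ?_) ?_ (hg.norm.const_mul M) ?_
  · exact (Continuous.aestronglyMeasurable (by fun_prop)).mul hg.aestronglyMeasurable
  · filter_upwards [hs] with x' hx'
    filter_upwards [hμ] with y hy
    rw [norm_mul]
    exact mul_le_mul_of_nonneg_right (hM x' hx' y hy) (norm_nonneg _)
  · refine Filter.Eventually.of_forall fun y => ?_
    have : Continuous fun x' => H x' y * g y := by fun_prop
    exact this.continuousAt

theorem hasDerivAt_integral_mul (hT : IsCompact T) (hμ : ∀ᵐ y ∂μ, y ∈ T) (hg : Integrable g μ)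
    {H H' : ℝ → Y → ℝ} (hH : ∀ t, Continuous (H t))
    (hH' : Continuous fun z : ℝ × Y => H' z.1 z.2)
    (hd : ∀ t y, HasDerivAt (fun s => H s y) (H' t y) t) (t : ℝ) :
    HasDerivAt (fun s => ∫ y, H s y * g y ∂μ) (∫ y, H' t y * g y ∂μ) t := by
  obtain ⟨s, hs, M, hM⟩ := exists_bound_near_of_continuous hT hH' t
  refine (hasDerivAt_integral_of_dominated_loc_of_deriv_le (bound := fun y => M * ‖g y‖)
    (F := fun s y => H s y * g y) (F' := fun s y => H' s y * g y) hs
    (Filter.Eventually.of_forall fun x' => ?_) ?_ ?_ ?_ (hg.norm.const_mul M) ?_).2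
  · exact (hH x').aestronglyMeasurable.mul hg.aestronglyMeasurable
  · exact integrable_continuous_mul hT hμ hg (hH t)
  · exact (Continuous.aestronglyMeasurable (by fun_prop)).mul hg.aestronglyMeasurable
  · filter_upwards [hμ] with y hy x' hx'
    rw [norm_mul]
    exact mul_le_mul_of_nonneg_right (hM x' hx' y hy) (norm_nonneg _)
  · exact Filter.Eventually.of_forall fun y x' _ => (hd x' y).mul_const _

theorem hasSecondDerivAt_integral_mul (hT : IsCompact T) (hμ : ∀ᵐ y ∂μ, y ∈ T)
    (hg : Integrable g μ) {H H' H'' : ℝ → Y → ℝ} (hH : ∀ t, Continuous (H t))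
    (hH' : Continuous fun z : ℝ × Y => H' z.1 z.2)
    (hH'' : Continuous fun z : ℝ × Y => H'' z.1 z.2)
    (hd : ∀ t y, HasDerivAt (fun s => H s y) (H' t y) t)
    (hd' : ∀ t y, HasDerivAt (fun s => H' s y) (H'' t y) t) (t : ℝ) :
    HasSecondDerivAt (fun s => ∫ y, H s y * g y ∂μ) (∫ y, H'' t y * g y ∂μ) t :=
  ⟨_, Filter.Eventually.of_forall (hasDerivAt_integral_mul hT hμ hg hH hH' hd),
    hasDerivAt_integral_mul hT hμ hg (fun t => by fun_prop) hH'' hd' t⟩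

end ParametricIntegral

section Laplacian

variable {ι V : Type*} [Fintype ι] [NormedAddCommGroup V] [NormedSpace ℝ V] {b : ι → V}

/-- `f` has second derivatives at `x` in the directions `b i`, and their sum is `L`. -/
def HasLaplacianAlong (b : ι → V) (f : V → ℝ) (L : ℝ) (x : V) : Prop :=
  ∃ D : ι → ℝ, (∀ i, HasSecondDerivAt (fun t : ℝ => f (x + t • b i)) (D i) 0) ∧ ∑ i, D i = L

theorem HasLaplacianAlong.add {f g : V → ℝ} {L L' : ℝ} {x : V} (hf : HasLaplacianAlong b f L x)
    (hg : HasLaplacianAlong b g L' x) :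
    HasLaplacianAlong b (fun y => f y + g y) (L + L') x := by
  obtain ⟨D, hD, rfl⟩ := hf
  obtain ⟨D', hD', rfl⟩ := hg
  exact ⟨fun i => D i + D' i, fun i => (hD i).add (hD' i), Finset.sum_add_distrib⟩

theorem HasLaplacianAlong.const_mul {f : V → ℝ} {L : ℝ} {x : V} (c : ℝ)
    (hf : HasLaplacianAlong b f L x) : HasLaplacianAlong b (fun y => c * f y) (c * L) x := by
  obtain ⟨D, hD, rfl⟩ := hf
  exact ⟨fun i => c * D i, fun i => (hD i).const_mul c, (Finset.mul_sum _ _ _).symm⟩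

theorem HasLaplacianAlong.nonpos_of_isLocalMax {f : V → ℝ} {L : ℝ} {x : V}
    (hf : HasLaplacianAlong b f L x) (hmax : IsLocalMax f x) : L ≤ 0 := by
  obtain ⟨D, hD, rfl⟩ := hf
  refine Finset.sum_nonpos fun i _ => (hD i).nonpos_of_isLocalMax ?_
  have hc : ContinuousAt (fun t : ℝ => x + t • b i) 0 := by fun_prop
  have hx : x + (0 : ℝ) • b i = x := by simp
  have hc' : Tendsto (fun t : ℝ => x + t • b i) (𝓝 0) (𝓝 x) := by simpa [ContinuousAt] using hc
  have := hc'.eventually hmax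
  simpa [IsLocalMax, IsMaxFilter] using this

theorem hasLaplacianAlong_lap {N : ℕ} {u : EuclideanSpace ℝ (Fin N) → ℝ}
    {x : EuclideanSpace ℝ (Fin N)} (hu : ContDiffAt ℝ 2 u x) :
    HasLaplacianAlong (fun i => EuclideanSpace.single i (1 : ℝ)) u (lap u x) x := by
  refine ⟨_, fun i => ?_, rfl⟩
  set e : EuclideanSpace ℝ (Fin N) := EuclideanSpace.single i 1
  have hline : ∀ t : ℝ, HasDerivAt (fun t : ℝ => x + t • e) e t := fun t => by
    simpa using ((hasDerivAt_id t).smul_const e).const_add x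
  have hx : x + (0 : ℝ) • e = x := by simp
  refine ⟨fun t => fderiv ℝ u (x + t • e) e, ?_, ?_⟩
  · have hev : ∀ᶠ y in 𝓝 x, DifferentiableAt ℝ u y :=
      (hu.eventually (by simp)).mono fun y hy => hy.differentiableAt (by simp)
    have hc : ContinuousAt (fun t : ℝ => x + t • e) 0 := (hline 0).continuousAt
    have hc' : Tendsto (fun t : ℝ => x + t • e) (𝓝 0) (𝓝 x) := by
      simpa [ContinuousAt] using hc
    filter_upwards [hc'.eventually hev] with t ht
    exact ht.hasFDerivAt.comp_hasDerivAt t (hline t)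
  · have hd : DifferentiableAt ℝ (fun y => fderiv ℝ u y e) x := by
      have : ContDiffAt ℝ 1 (fderiv ℝ u) x := hu.fderiv_right (by norm_num)
      exact (this.differentiableAt (by simp)).clm_apply (differentiableAt_const e)
    have hd' := hd.hasFDerivAt
    rw [← hx] at hd'
    have := hd'.comp_hasDerivAt (0 : ℝ) (hline 0)
    rw [hx] at this
    exact this

end Laplacian

section Potential

open RealInnerProductSpace

variable {ι V : Type*} [Fintype ι] [NormedAddCommGroup V] [InnerProductSpace ℝ V]

theorem hasLaplacianAlong_norm_sq (b : OrthonormalBasis ι ℝ V) (x : V) :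
    HasLaplacianAlong b (fun y => ‖y‖ ^ 2) (2 * Fintype.card ι) x := by
  refine ⟨fun _ => 2, fun i => ⟨fun t => 2 * ⟪x, b i⟫ + 2 * t, ?_, ?_⟩, by simp [mul_comm]⟩
  · have h : (fun t : ℝ => ‖x + t • b i‖ ^ 2) = fun t => ‖x‖ ^ 2 + 2 * ⟪x, b i⟫ * t + t ^ 2 := by
      funext t
      rw [norm_add_sq_real, inner_smul_right, norm_smul, b.norm_eq_one]
      simp
      ring
    rw [h]
    refine Filter.Eventually.of_forall fun t => ?_
    have := ((hasDerivAt_id t).const_mul (2 * ⟪x, b i⟫)).const_add (‖x‖ ^ 2) |>.add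
      ((hasDerivAt_id t).pow 2)
    convert! this using 1
    simp
  · have := ((hasDerivAt_id (0 : ℝ)).const_mul 2).const_add (2 * ⟪x, b i⟫)
    convert! this using 1
    simp

/-- The quadratic polynomial `α y * ‖x‖ ^ 2 - 2 * ⟪y, x⟫ + γ y` in `x`. -/
noncomputable def quadForm (α γ : V → ℝ) (x y : V) : ℝ := α y * ‖x‖ ^ 2 - 2 * ⟪y, x⟫ + γ y

theorem continuous_quadForm {α γ : V → ℝ} (hα : Continuous α) (hγ : Continuous γ) :
    Continuous fun z : V × V => quadForm α γ z.1 z.2 := by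
  unfold quadForm
  fun_prop

theorem continuous_negPowPrimitive_quadForm (m : ℝ) {α γ : V → ℝ} (hα : Continuous α)
    (hγ : Continuous γ) (hpos : ∀ x y, 0 < quadForm α γ x y) :
    Continuous fun z : V × V => negPowPrimitive m (quadForm α γ z.1 z.2) :=
  continuous_iff_continuousAt.2 fun z =>
    (hasDerivAt_negPowPrimitive m (hpos z.1 z.2)).continuousAt.comp
      (f := fun z : V × V => quadForm α γ z.1 z.2) (continuous_quadForm hα hγ).continuousAt

theorem hasDerivAt_quadForm_line (α γ : V → ℝ) (x y e : V) (t : ℝ) :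
    HasDerivAt (fun s : ℝ => quadForm α γ (x + s • e) y)
      (2 * α y * (⟪x, e⟫ + t * ‖e‖ ^ 2) - 2 * ⟪y, e⟫) t := by
  have h : (fun s : ℝ => quadForm α γ (x + s • e) y) = fun s : ℝ =>
      (α y * ‖x‖ ^ 2 - 2 * ⟪y, x⟫ + γ y) + (2 * α y * ⟪x, e⟫ - 2 * ⟪y, e⟫) * s
        + α y * ‖e‖ ^ 2 * s ^ 2 := by
    funext s
    rw [quadForm, norm_add_sq_real, inner_smul_right, norm_smul, inner_add_right, inner_smul_right,
      mul_pow, Real.norm_eq_abs, sq_abs]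
    ring
  rw [h]
  have := (((hasDerivAt_id t).const_mul (2 * α y * ⟪x, e⟫ - 2 * ⟪y, e⟫)).const_add
    (α y * ‖x‖ ^ 2 - 2 * ⟪y, x⟫ + γ y)).add
      (((hasDerivAt_id t).pow 2).const_mul (α y * ‖e‖ ^ 2))
  convert! this using 1
  simp
  ring

theorem hasLaplacianAlong_integral_quadForm [MeasurableSpace V] [OpensMeasurableSpace V]
    {μ : Measure V} {T : Set V} {g : V → ℝ} (hT : IsCompact T) (hμ : ∀ᵐ y ∂μ, y ∈ T)
    (hg : Integrable g μ) (b : OrthonormalBasis ι ℝ V) (m : ℝ) {α γ : V → ℝ} (hα : Continuous α)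
    (hγ : Continuous γ) (hpos : ∀ x y, 0 < quadForm α γ x y) (x : V) :
    HasLaplacianAlong b (fun x => ∫ y, negPowPrimitive m (quadForm α γ x y) * g y ∂μ)
      (∫ y, (4 * m * quadForm α γ x y ^ (-m - 1) * ‖α y • x - y‖ ^ 2
        - 2 * Fintype.card ι * α y * quadForm α γ x y ^ (-m)) * g y ∂μ) x := by
  have hcont := continuous_quadForm hα hγ
  have hpow : ∀ (k : ℝ) (e : V),
      Continuous fun z : ℝ × V => quadForm α γ (x + z.1 • e) z.2 ^ k := fun k e =>
    (hcont.comp (f := fun z : ℝ × V => (x + z.1 • e, z.2)) (by fun_prop)).rpow_const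
      fun z => Or.inl (hpos _ _).ne'
  have hpow0 : ∀ k : ℝ, Continuous fun y : V => quadForm α γ x y ^ k := fun k =>
    (hcont.comp (f := fun y : V => (x, y)) (by fun_prop)).rpow_const
      fun z => Or.inl (hpos _ _).ne'
  have hder : ∀ (y e : V) (t : ℝ), HasDerivAt
      (fun s : ℝ => 2 * α y * (⟪x, e⟫ + s * ‖e‖ ^ 2) - 2 * ⟪y, e⟫) (2 * α y * ‖e‖ ^ 2) t := by
    intro y e t
    have := ((((hasDerivAt_id t).mul_const (‖e‖ ^ 2)).const_add ⟪x, e⟫).const_mul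
      (2 * α y)).sub_const (2 * ⟪y, e⟫)
    convert! this using 1
    simp
  refine ⟨_, fun i => hasSecondDerivAt_integral_mul hT hμ hg
    (H := fun t y => negPowPrimitive m (quadForm α γ (x + t • b i) y))
    (fun t => (continuous_negPowPrimitive_quadForm m hα hγ hpos).comp
      (f := fun y => (x + t • b i, y)) (by fun_prop)) ?_ ?_
    (fun t y => hasDerivAt_negPowPrimitive_comp m
      (hasDerivAt_quadForm_line α γ x y (b i) t) (hpos _ _))
    (fun t y => hasDerivAt_neg_rpow_mul m (hasDerivAt_quadForm_line α γ x y (b i) t)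
      (hder y (b i) t) (hpos _ _)) 0, ?_⟩
  · exact ((hpow _ _).mul (by fun_prop)).neg
  · exact ((continuous_const.mul (hpow _ _)).mul (by fun_prop)).sub
      ((hpow _ _).mul (by fun_prop))
  · simp only [zero_smul, add_zero, zero_mul]
    rw [← integral_finsetSum]
    · congr 1
      funext y
      rw [← Finset.sum_mul]
      congr 1
      have hsum : ∑ i, (2 * α y * ⟪x, b i⟫ - 2 * ⟪y, b i⟫) ^ 2 = 4 * ‖α y • x - y‖ ^ 2 := by
        rw [← b.sum_sq_inner_left, Finset.mul_sum]
        refine Finset.sum_congr rfl fun i _ => ?_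
        rw [inner_sub_left, real_inner_smul_left]
        ring
      rw [Finset.sum_sub_distrib, ← Finset.mul_sum, hsum]
      simp
      ring
    · intro i _
      refine integrable_continuous_mul hT hμ hg ?_
      exact ((continuous_const.mul (hpow0 _)).mul (by fun_prop)).sub
        ((hpow0 _).mul (by fun_prop))

end Potential

section GreenKernel

open RealInnerProductSpace

variable {V : Type*} [NormedAddCommGroup V] [InnerProductSpace ℝ V]

/-- The regularised squared distance between `x` and `y`. -/
noncomputable def directForm (d : ℝ) : V → V → ℝ :=
  quadForm (fun _ => 1) (fun y => ‖y‖ ^ 2 + d)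

/-- The regularised squared distance between `x` and the image of `y` under inversion in the unit
sphere, scaled by `‖y‖ ^ 2`. -/
noncomputable def imageForm (d : ℝ) : V → V → ℝ :=
  quadForm (fun y => ‖y‖ ^ 2) (fun _ => 1 + d)

theorem directForm_eq (d : ℝ) (x y : V) : directForm d x y = ‖x - y‖ ^ 2 + d := by
  rw [directForm, quadForm, norm_sub_sq_real, real_inner_comm]
  ring

theorem imageForm_eq (d : ℝ) (x y : V) :
    imageForm d x y = directForm d x y + (1 - ‖x‖ ^ 2) * (1 - ‖y‖ ^ 2) := by
  rw [imageForm, directForm, quadForm, quadForm]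
  ring

theorem directForm_pos {d : ℝ} (hd : 0 < d) (x y : V) : 0 < directForm d x y := by
  rw [directForm_eq]
  positivity

theorem sq_add_le_imageForm (d : ℝ) (x y : V) : (1 - ‖x‖ * ‖y‖) ^ 2 + d ≤ imageForm d x y := by
  have := real_inner_le_norm y x
  rw [imageForm, quadForm]
  nlinarith

theorem imageForm_pos {d : ℝ} (hd : 0 < d) (x y : V) : 0 < imageForm d x y :=
  lt_of_lt_of_le (by positivity) (sq_add_le_imageForm d x y)

theorem directForm_le_imageForm (d : ℝ) {x y : V} (hx : ‖x‖ ≤ 1) (hy : ‖y‖ ≤ 1) :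
    directForm d x y ≤ imageForm d x y := by
  rw [imageForm_eq]
  have h1 : 0 ≤ 1 - ‖x‖ ^ 2 := by nlinarith [norm_nonneg x]
  have h2 : 0 ≤ 1 - ‖y‖ ^ 2 := by nlinarith [norm_nonneg y]
  nlinarith [mul_nonneg h1 h2]

/-- A smooth approximation of a multiple of the Green function of the unit ball. -/
noncomputable def greenKernel (m d : ℝ) (x y : V) : ℝ :=
  negPowPrimitive m (directForm d x y) - negPowPrimitive m (imageForm d x y)

theorem greenKernel_nonneg (m : ℝ) {d : ℝ} (hd : 0 < d) {x y : V} (hx : ‖x‖ ≤ 1) (hy : ‖y‖ ≤ 1) :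
    0 ≤ greenKernel m d x y :=
  sub_nonneg.2 (negPowPrimitive_anti m (directForm_pos hd x y) (directForm_le_imageForm d hx hy))

theorem continuous_negPowPrimitive_directForm (m : ℝ) {d : ℝ} (hd : 0 < d) :
    Continuous fun z : V × V => negPowPrimitive m (directForm d z.1 z.2) :=
  continuous_negPowPrimitive_quadForm m (by fun_prop) (by fun_prop) (directForm_pos hd)

theorem continuous_negPowPrimitive_imageForm (m : ℝ) {d : ℝ} (hd : 0 < d) :
    Continuous fun z : V × V => negPowPrimitive m (imageForm d z.1 z.2) :=
  continuous_negPowPrimitive_quadForm m (by fun_prop) (by fun_prop) (imageForm_pos hd)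

theorem continuous_greenKernel (m : ℝ) {d : ℝ} (hd : 0 < d) :
    Continuous fun z : V × V => greenKernel m d z.1 z.2 :=
  (continuous_negPowPrimitive_directForm m hd).sub (continuous_negPowPrimitive_imageForm m hd)

theorem greenKernel_le {m : ℝ} (hm : 1 / 2 ≤ m) {d : ℝ} (hd : 0 < d) {x y : V} (hx : ‖x‖ < 1)
    (hy : ‖y‖ < 1) (hxy : y ≠ x) :
    greenKernel m d x y ≤ 8 * (1 - ‖x‖) * ‖x - y‖ ^ (-(2 * m - 1)) := by
  have hq := directForm_pos hd x y
  have he := imageForm_pos hd x y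
  have hx0 := norm_nonneg x
  have hy0 := norm_nonneg y
  have hs : 0 < ‖x - y‖ := norm_pos_iff.2 (sub_ne_zero.2 hxy.symm)
  have hse : 1 - ‖y‖ ≤ √(imageForm d x y) := by
    refine Real.le_sqrt_of_sq_le (le_trans ?_ (sq_add_le_imageForm d x y))
    have : ‖x‖ * ‖y‖ ≤ ‖y‖ := by nlinarith
    nlinarith
  have hfrac : 2 * (imageForm d x y - directForm d x y) / √(imageForm d x y)
      ≤ 8 * (1 - ‖x‖) := by
    rw [div_le_iff₀ (Real.sqrt_pos.2 he), imageForm_eq, add_sub_cancel_left, ← imageForm_eq]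
    have h1 : (1 - ‖x‖ ^ 2) * (1 - ‖y‖ ^ 2) ≤ 4 * ((1 - ‖x‖) * (1 - ‖y‖)) := by
      have h2 : (1 + ‖x‖) * (1 + ‖y‖) ≤ 4 := by nlinarith
      have h3 : 0 ≤ (1 - ‖x‖) * (1 - ‖y‖) := mul_nonneg (by linarith) (by linarith)
      nlinarith
    have h4 := mul_le_mul_of_nonneg_left hse (by linarith : 0 ≤ 1 - ‖x‖)
    linarith
  have hpow : directForm d x y ^ (-(m - 1 / 2)) ≤ ‖x - y‖ ^ (-(2 * m - 1)) := by
    have h1 : ‖x - y‖ ^ (-(2 * m - 1)) = (‖x - y‖ ^ 2) ^ (-(m - 1 / 2)) := by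
      rw [← Real.rpow_natCast, ← Real.rpow_mul hs.le]
      congr 1
      push_cast
      ring
    rw [h1]
    refine Real.rpow_le_rpow_of_nonpos (by positivity) ?_ (by linarith)
    rw [directForm_eq]
    linarith
  calc greenKernel m d x y ≤ _ :=
        negPowPrimitive_sub_le hm hq (directForm_le_imageForm d hx.le hy.le)
    _ ≤ 8 * (1 - ‖x‖) * ‖x - y‖ ^ (-(2 * m - 1)) :=
        mul_le_mul hfrac hpow (Real.rpow_nonneg hq.le _) (by linarith)

theorem hasLaplacianAlong_integral_greenKernel {ι : Type*} [Fintype ι] [MeasurableSpace V]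
    [OpensMeasurableSpace V] {μ : Measure V} {T : Set V} {g : V → ℝ} (hT : IsCompact T)
    (hμ : ∀ᵐ y ∂μ, y ∈ T) (hg : Integrable g μ) (b : OrthonormalBasis ι ℝ V) {d : ℝ} (hd : 0 < d)
    {m : ℝ} (hm : 2 * m = Fintype.card ι) (x : V) :
    HasLaplacianAlong b (fun x => ∫ y, greenKernel m d x y * g y ∂μ)
      (-∫ y, 4 * m * d * (directForm d x y ^ (-m - 1) - ‖y‖ ^ 2 * imageForm d x y ^ (-m - 1))
        * g y ∂μ) x := by
  have h1 : HasLaplacianAlong b (fun x => ∫ y, negPowPrimitive m (directForm d x y) * g y ∂μ)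
      (∫ y, (4 * m * directForm d x y ^ (-m - 1) * ‖(1 : ℝ) • x - y‖ ^ 2
        - 2 * Fintype.card ι * 1 * directForm d x y ^ (-m)) * g y ∂μ) x :=
    hasLaplacianAlong_integral_quadForm hT hμ hg b m (α := fun _ => 1)
      (γ := fun y => ‖y‖ ^ 2 + d) (by fun_prop) (by fun_prop) (directForm_pos hd) x
  have h2 : HasLaplacianAlong b (fun x => ∫ y, negPowPrimitive m (imageForm d x y) * g y ∂μ)
      (∫ y, (4 * m * imageForm d x y ^ (-m - 1) * ‖‖y‖ ^ 2 • x - y‖ ^ 2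
        - 2 * Fintype.card ι * ‖y‖ ^ 2 * imageForm d x y ^ (-m)) * g y ∂μ) x :=
    hasLaplacianAlong_integral_quadForm hT hμ hg b m (α := fun y => ‖y‖ ^ 2)
      (γ := fun _ => 1 + d) (by fun_prop) (by fun_prop) (imageForm_pos hd) x
  have hfib : ∀ z : V, Continuous fun y : V => ((z, y) : V × V) := fun z => by fun_prop
  have hcq : Continuous fun y => directForm d x y := by
    unfold directForm quadForm
    fun_prop
  have hce : Continuous fun y => imageForm d x y := by
    unfold imageForm quadForm
    fun_prop
  have hcqp : ∀ k : ℝ, Continuous fun y => directForm d x y ^ k := fun k =>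
    hcq.rpow_const fun y => Or.inl (directForm_pos hd x y).ne'
  have hcep : ∀ k : ℝ, Continuous fun y => imageForm d x y ^ k := fun k =>
    hce.rpow_const fun y => Or.inl (imageForm_pos hd x y).ne'
  have hfun : (fun x => ∫ y, greenKernel m d x y * g y ∂μ) = fun x =>
      (∫ y, negPowPrimitive m (directForm d x y) * g y ∂μ)
        + -1 * ∫ y, negPowPrimitive m (imageForm d x y) * g y ∂μ := by
    funext z
    have hi1 : Integrable (fun y => negPowPrimitive m (directForm d z y) * g y) μ :=
      integrable_continuous_mul hT hμ hg <| by
        have := (continuous_negPowPrimitive_directForm m hd).comp (hfib z)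
        exact this
    have hi2 : Integrable (fun y => negPowPrimitive m (imageForm d z y) * g y) μ :=
      integrable_continuous_mul hT hμ hg <| by
        have := (continuous_negPowPrimitive_imageForm m hd).comp (hfib z)
        exact this
    rw [neg_one_mul, ← sub_eq_add_neg, ← integral_sub hi1 hi2]
    simp only [greenKernel, sub_mul]
  rw [hfun]
  convert h1.add (h2.const_mul (-1)) using 1
  · rw [neg_one_mul, ← sub_eq_add_neg, ← integral_sub, ← integral_neg]
    · congr 1
      funext y
      have e1 : directForm d x y ^ (-m) = directForm d x y ^ (-m - 1) * directForm d x y := by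
        rw [← Real.rpow_add_one (directForm_pos hd x y).ne', sub_add_cancel]
      have e2 : imageForm d x y ^ (-m) = imageForm d x y ^ (-m - 1) * imageForm d x y := by
        rw [← Real.rpow_add_one (imageForm_pos hd x y).ne', sub_add_cancel]
      have e3 : ‖(1 : ℝ) • x - y‖ ^ 2 = directForm d x y - d := by
        rw [directForm_eq, one_smul]
        ring
      have e4 : ‖‖y‖ ^ 2 • x - y‖ ^ 2 = ‖y‖ ^ 2 * (imageForm d x y - d) := by
        rw [imageForm, quadForm, norm_sub_sq_real, real_inner_smul_left, norm_smul,
          Real.norm_eq_abs, abs_of_nonneg (sq_nonneg ‖y‖), real_inner_comm]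
        ring
      rw [e1, e2, e3, e4, ← hm]
      ring
    · refine integrable_continuous_mul hT hμ hg ?_
      exact ((continuous_const.mul (hcqp _)).mul (by fun_prop)).sub
        (continuous_const.mul (hcqp _))
    · refine integrable_continuous_mul hT hμ hg ?_
      exact ((continuous_const.mul (hcep _)).mul (by fun_prop)).sub
        (Continuous.mul (by fun_prop) (hcep _))

theorem rpow_imageForm_le {m d : ℝ} (hm : 0 ≤ m) (hd : 0 < d) {x y : V} (hx : ‖x‖ ≤ 1)
    (hy : ‖y‖ ≤ 1) :
    ‖y‖ ^ 2 * imageForm d x y ^ (-m - 1) ≤ directForm d x y ^ (-m - 1) := by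
  have h1 : imageForm d x y ^ (-m - 1) ≤ directForm d x y ^ (-m - 1) :=
    Real.rpow_le_rpow_of_nonpos (directForm_pos hd x y) (directForm_le_imageForm d hx hy)
      (by linarith)
  have h2 := Real.rpow_nonneg (imageForm_pos hd x y).le (-m - 1)
  have h3 : ‖y‖ ^ 2 ≤ 1 := by nlinarith [norm_nonneg y]
  nlinarith

theorem half_rpow_le_sub {m d r : ℝ} (hm : 0 ≤ m) (hd : 0 < d) (hr : r < 1)
    (hdr : 2 * d ≤ (1 - r ^ 2) ^ 2) {x y : V} (hx : ‖x‖ ≤ r) (hy : ‖y‖ ≤ r)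
    (hxy : ‖x - y‖ ^ 2 ≤ d) :
    (2 * d) ^ (-m - 1) / 2
      ≤ directForm d x y ^ (-m - 1) - ‖y‖ ^ 2 * imageForm d x y ^ (-m - 1) := by
  have hx0 := norm_nonneg x
  have hy0 := norm_nonneg y
  have hq := directForm_pos hd x y
  have hq2 : directForm d x y ≤ 2 * d := by rw [directForm_eq]; linarith
  have he : 2 * directForm d x y ≤ imageForm d x y := by
    rw [imageForm_eq]
    have h1 : 1 - r ^ 2 ≤ 1 - ‖x‖ ^ 2 := by nlinarith
    have h2 : 1 - r ^ 2 ≤ 1 - ‖y‖ ^ 2 := by nlinarith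
    have h3 : 0 ≤ 1 - r ^ 2 := by nlinarith
    nlinarith [mul_le_mul h1 h2 h3 (h3.trans h1)]
  have h1 : imageForm d x y ^ (-m - 1) ≤ (2 * directForm d x y) ^ (-m - 1) :=
    Real.rpow_le_rpow_of_nonpos (by positivity) he (by linarith)
  rw [Real.mul_rpow (by norm_num) hq.le] at h1
  have h2 : (2 : ℝ) ^ (-m - 1) ≤ 1 / 2 := by
    calc (2 : ℝ) ^ (-m - 1) ≤ 2 ^ (-1 : ℝ) :=
          Real.rpow_le_rpow_of_exponent_le (by norm_num) (by linarith)
      _ = 1 / 2 := by norm_num [Real.rpow_neg_one]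
  have h3 := Real.rpow_nonneg hq.le (-m - 1)
  have h4 := Real.rpow_nonneg (imageForm_pos hd x y).le (-m - 1)
  have h5 : ‖y‖ ^ 2 ≤ 1 := by nlinarith
  have h6 : (2 * d) ^ (-m - 1) ≤ directForm d x y ^ (-m - 1) :=
    Real.rpow_le_rpow_of_nonpos hq hq2 (by linarith)
  have h7 := mul_le_mul_of_nonneg_right h2 h3
  have h8 := mul_le_mul_of_nonneg_right h5 h4
  linarith

end GreenKernel

section BallEstimates

open RealInnerProductSpace

theorem memLp_of_continuousOn_of_integrableOn_rpow {X : Type*}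
    [TopologicalSpace X] [MeasurableSpace X] [OpensMeasurableSpace X] {μ : Measure X} {S : Set X}
    (hS : MeasurableSet S) {g : X → ℝ} {p : ℝ} (hp : 0 < p) (hg : ContinuousOn g S) (hg0 : ∀ x ∈ S, 0 ≤ g x)
    (hgp : IntegrableOn (fun x => g x ^ p) S μ) : MemLp g (ENNReal.ofReal p) (μ.restrict S) := by
  rw [← integrable_norm_rpow_iff (hg.aestronglyMeasurable hS) (by simpa using hp) (by simp),
    ENNReal.toReal_ofReal hp.le]
  refine hgp.congr_fun (fun x hx => ?_) hS
  simp only [Real.norm_of_nonneg (hg0 x hx)]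

theorem ae_restrict_ball_mem_closedBall {V : Type*} [SeminormedAddCommGroup V]
    [MeasurableSpace V] [OpensMeasurableSpace V] {μ : Measure V} :
    ∀ᵐ y ∂μ.restrict (ball (0 : V) 1), y ∈ closedBall 0 1 :=
  (ae_restrict_mem measurableSet_ball).mono fun _ hy => ball_subset_closedBall hy

theorem integral_greenKernel_nonneg {V : Type*} [NormedAddCommGroup V]
    [InnerProductSpace ℝ V] [MeasurableSpace V] [OpensMeasurableSpace V] {μ : Measure V} (m : ℝ) {d : ℝ} (hd : 0 < d) {g : V → ℝ}
    (hg0 : ∀ x ∈ ball (0 : V) 1, 0 ≤ g x) {x : V} (hx : ‖x‖ ≤ 1) :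
    0 ≤ ∫ y in ball 0 1, greenKernel m d x y * g y ∂μ :=
  setIntegral_nonneg measurableSet_ball fun y hy =>
    mul_nonneg (greenKernel_nonneg m hd hx (mem_ball_zero_iff.1 hy).le) (hg0 y hy)

theorem exists_le_of_continuousOn_closedBall {V : Type*} [NormedAddCommGroup V]
    [NormedSpace ℝ V] [ProperSpace V] {u : V → ℝ} (hu : ContinuousOn u (closedBall 0 1))
    (hu0 : ∀ x ∈ sphere (0 : V) 1, u x ≤ 0) {ε s : ℝ} (hε : 0 < ε) (hs : s < 1) :
    ∃ r, s ≤ r ∧ 0 < r ∧ r < 1 ∧ ∀ x ∈ closedBall (0 : V) 1, r ≤ ‖x‖ → u x ≤ ε := by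
  obtain ⟨η, hη, h⟩ := Metric.uniformContinuousOn_iff.1
    ((isCompact_closedBall (0 : V) 1).uniformContinuousOn_of_continuous hu) ε hε
  refine ⟨max s (max (1 - η / 2) (1 / 2)), le_max_left _ _, by positivity, ?_, fun x hx hrx => ?_⟩
  · simp only [max_lt_iff]
    exact ⟨hs, by linarith, by norm_num⟩
  · have h1 : 1 - η / 2 ≤ ‖x‖ := (le_max_left _ _).trans ((le_max_right _ _).trans hrx)
    have h2 : 1 / 2 ≤ ‖x‖ := (le_max_right _ _).trans ((le_max_right _ _).trans hrx)
    have hx1 : ‖x‖ ≤ 1 := mem_closedBall_zero_iff.1 hx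
    have hx0 : 0 < ‖x‖ := by linarith
    have hz : ‖‖x‖⁻¹ • x‖ = 1 := by
      rw [norm_smul, norm_inv, norm_norm, inv_mul_cancel₀ hx0.ne']
    have hdist : dist x (‖x‖⁻¹ • x) = 1 - ‖x‖ := by
      have : x - ‖x‖⁻¹ • x = (1 - ‖x‖⁻¹) • x := by rw [sub_smul, one_smul]
      rw [dist_eq_norm, this, norm_smul, Real.norm_eq_abs, abs_sub_comm,
        abs_of_nonneg (sub_nonneg.2 ((one_le_inv₀ hx0).2 hx1)), sub_mul,
        inv_mul_cancel₀ hx0.ne', one_mul]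
    have h3 := h x hx (‖x‖⁻¹ • x) (mem_closedBall_zero_iff.2 hz.le) (by rw [hdist]; linarith)
    have h4 := hu0 (‖x‖⁻¹ • x) (mem_sphere_zero_iff_norm.2 hz)
    rw [Real.dist_eq] at h3
    linarith [(abs_lt.1 h3).2]

variable {V : Type*} [NormedAddCommGroup V] [InnerProductSpace ℝ V] [FiniteDimensional ℝ V]
  [MeasurableSpace V] [BorelSpace V] {μ : Measure V} [μ.IsAddHaarMeasure]

theorem integrableOn_norm_rpow_ball [Nontrivial V] {k : ℝ} (hk : k < Module.finrank ℝ V) {R : ℝ}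
    (hR : 0 ≤ R) : IntegrableOn (fun x : V => ‖x‖ ^ (-k)) (ball 0 R) μ := by
  rw [integrableOn_fun_norm_addHaar μ (f := fun s : ℝ => s ^ (-k))]
  have h : IntegrableOn (fun s : ℝ => s ^ ((Module.finrank ℝ V : ℝ) - 1 - k)) (Ioo 0 R) :=
    (intervalIntegrable_iff_integrableOn_Ioo_of_le hR).1
      (intervalIntegral.intervalIntegrable_rpow' (by linarith))
  refine h.congr_fun (fun s hs => ?_) measurableSet_Ioo
  have hV : 1 ≤ Module.finrank ℝ V := Module.finrank_pos
  simp only [smul_eq_mul]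
  rw [← Real.rpow_natCast, ← Real.rpow_add hs.1]
  push_cast [hV]
  rfl

theorem integral_norm_sub_rpow_ball_le [Nontrivial V] {k : ℝ} (hk : k < Module.finrank ℝ V) {x : V}
    (hx : ‖x‖ ≤ 1) :
    IntegrableOn (fun y => ‖x - y‖ ^ (-k)) (ball 0 1) μ ∧
      ∫ y in ball 0 1, ‖x - y‖ ^ (-k) ∂μ ≤ ∫ z in ball (0 : V) 2, ‖z‖ ^ (-k) ∂μ := by
  set h : V → ℝ := (ball (0 : V) 2).indicator fun z => ‖z‖ ^ (-k)
  have hint : Integrable h μ :=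
    (integrableOn_norm_rpow_ball hk zero_le_two).integrable_indicator measurableSet_ball
  have hint' : Integrable (fun y => h (x - y)) μ := hint.comp_sub_left x
  have heq : EqOn (fun y => h (x - y)) (fun y => ‖x - y‖ ^ (-k)) (ball 0 1) := fun y hy => by
    refine indicator_of_mem ?_ _
    rw [mem_ball_zero_iff] at hy ⊢
    linarith [norm_sub_le x y]
  refine ⟨hint'.integrableOn.congr_fun heq measurableSet_ball, ?_⟩
  calc ∫ y in ball 0 1, ‖x - y‖ ^ (-k) ∂μ = ∫ y in ball 0 1, h (x - y) ∂μ :=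
        (setIntegral_congr_fun measurableSet_ball heq).symm
    _ ≤ ∫ y, h (x - y) ∂μ := setIntegral_le_integral hint' (Filter.Eventually.of_forall fun y =>
        indicator_nonneg (fun z _ => Real.rpow_nonneg (norm_nonneg z) _) _)
    _ = ∫ z, h z ∂μ := integral_sub_left_eq_self h μ x
    _ = _ := integral_indicator measurableSet_ball

theorem integral_norm_sub_rpow_mul_le [Nontrivial V] {k p q : ℝ} (hpq : p.HolderConjugate q)
    (hk : k * q < Module.finrank ℝ V) {g : V → ℝ} (hg : ContinuousOn g (ball 0 1))
    (hg0 : ∀ x ∈ ball (0 : V) 1, 0 ≤ g x) (hgp : IntegrableOn (fun x => g x ^ p) (ball 0 1) μ)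
    {x : V} (hx : ‖x‖ ≤ 1) :
    IntegrableOn (fun y => ‖x - y‖ ^ (-k) * g y) (ball 0 1) μ ∧
      ∫ y in ball 0 1, ‖x - y‖ ^ (-k) * g y ∂μ ≤
        (∫ z in ball (0 : V) 2, ‖z‖ ^ (-(k * q)) ∂μ) ^ (1 / q) *
          (∫ y in ball 0 1, g y ^ p ∂μ) ^ (1 / p) := by
  obtain ⟨hI, hle⟩ := integral_norm_sub_rpow_ball_le (μ := μ) hk hx
  have hpow : ∀ y : V, (‖x - y‖ ^ (-k)) ^ q = ‖x - y‖ ^ (-(k * q)) := fun y => by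
    rw [← Real.rpow_mul (norm_nonneg _), neg_mul]
  have hmeas : Measurable fun y : V => ‖x - y‖ ^ (-k) := by fun_prop
  have h1 : MemLp (fun y => ‖x - y‖ ^ (-k)) (ENNReal.ofReal q) (μ.restrict (ball 0 1)) := by
    rw [← integrable_norm_rpow_iff hmeas.aestronglyMeasurable (by simpa using hpq.symm.pos)
      (by simp), ENNReal.toReal_ofReal hpq.symm.nonneg]
    refine hI.congr_fun (fun y _ => ?_) measurableSet_ball
    simp only [Real.norm_of_nonneg (Real.rpow_nonneg (norm_nonneg (x - y)) (-k)), hpow]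
  have h2 := memLp_of_continuousOn_of_integrableOn_rpow (μ := μ) measurableSet_ball hpq.pos hg hg0
    hgp
  have : ENNReal.HolderConjugate (ENNReal.ofReal q) (ENNReal.ofReal p) := hpq.symm.ennrealOfReal
  refine ⟨h1.integrable_mul h2, ?_⟩
  refine (integral_mul_le_Lp_mul_Lq_of_nonneg hpq.symm
    (Filter.Eventually.of_forall fun y => Real.rpow_nonneg (norm_nonneg _) _)
    ((ae_restrict_iff' measurableSet_ball).2 (Filter.Eventually.of_forall hg0)) h1 h2).trans ?_
  simp only [hpow]
  refine mul_le_mul_of_nonneg_right (Real.rpow_le_rpow ?_ hle (by simpa using hpq.symm.nonneg))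
    (Real.rpow_nonneg (setIntegral_nonneg measurableSet_ball fun y hy =>
      Real.rpow_nonneg (hg0 y hy) _) _)
  exact integral_nonneg fun y => Real.rpow_nonneg (norm_nonneg _) _

theorem integral_greenKernel_le [Nontrivial V] {m : ℝ} (hm : 1 / 2 ≤ m) {d : ℝ} (hd : 0 < d)
    {g : V → ℝ} (hg : IntegrableOn g (ball 0 1) μ) (hg0 : ∀ x ∈ ball (0 : V) 1, 0 ≤ g x) {x : V}
    (hx : ‖x‖ < 1) (hI : IntegrableOn (fun y => ‖x - y‖ ^ (-(2 * m - 1)) * g y) (ball 0 1) μ) :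
    ∫ y in ball 0 1, greenKernel m d x y * g y ∂μ ≤
      8 * (1 - ‖x‖) * ∫ y in ball 0 1, ‖x - y‖ ^ (-(2 * m - 1)) * g y ∂μ := by
  rw [← integral_const_mul]
  refine integral_mono_ae ?_ (hI.const_mul _) ?_
  · refine integrable_continuous_mul (isCompact_closedBall 0 1) ae_restrict_ball_mem_closedBall hg ?_
    have := (continuous_greenKernel m hd).comp
      (continuous_const.prodMk continuous_id : Continuous fun y : V => (x, y))
    exact this
  · have hne : ∀ᵐ y ∂μ.restrict (ball (0 : V) 1), y ≠ x :=
      ae_restrict_of_ae (by simp [ae_iff])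
    filter_upwards [hne, ae_restrict_mem measurableSet_ball] with y hy hyB
    rw [← mul_assoc]
    exact mul_le_mul_of_nonneg_right
      (greenKernel_le hm hd hx (mem_ball_zero_iff.1 hyB) hy) (hg0 y hyB)

theorem le_integral_directForm_sub_imageForm {m : ℝ} (hm : 0 ≤ m)
    (hmV : 2 * m = Module.finrank ℝ V) {r δ G : ℝ} (hr : r < 1) (hδ : 0 < δ)
    (hδr : 2 * δ ^ 2 ≤ (1 - r ^ 2) ^ 2) {g : V → ℝ} (hg : IntegrableOn g (ball 0 1) μ)
    (hg0 : ∀ x ∈ ball (0 : V) 1, 0 ≤ g x) {x : V} (hx : ‖x‖ ≤ r)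
    (hxr : ∀ y ∈ ball x δ, ‖y‖ ≤ r ∧ G ≤ g y) :
    2 * m * 2 ^ (-m - 1) * μ.real (ball 0 1) * G ≤
      ∫ y in ball 0 1, 4 * m * δ ^ 2 * (directForm (δ ^ 2) x y ^ (-m - 1)
        - ‖y‖ ^ 2 * imageForm (δ ^ 2) x y ^ (-m - 1)) * g y ∂μ := by
  have hd : 0 < δ ^ 2 := by positivity
  have hsub : ball x δ ⊆ ball 0 1 := fun y hy =>
    mem_ball_zero_iff.2 ((hxr y hy).1.trans_lt hr)
  set F : V → ℝ := fun y => 4 * m * δ ^ 2 * (directForm (δ ^ 2) x y ^ (-m - 1)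
        - ‖y‖ ^ 2 * imageForm (δ ^ 2) x y ^ (-m - 1))
  have hFc : Continuous F := by
    have hcq : Continuous fun y => directForm (δ ^ 2) x y := by
      unfold directForm quadForm
      fun_prop
    have hce : Continuous fun y => imageForm (δ ^ 2) x y := by
      unfold imageForm quadForm
      fun_prop
    have hcq' := hcq.rpow_const (p := -m - 1) fun y => Or.inl (directForm_pos hd x y).ne'
    have hce' := hce.rpow_const (p := -m - 1) fun y => Or.inl (imageForm_pos hd x y).ne'
    fun_prop
  have hFI : IntegrableOn (fun y => F y * g y) (ball 0 1) μ :=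
    integrable_continuous_mul (isCompact_closedBall 0 1) ae_restrict_ball_mem_closedBall hg hFc
  have hF0 : ∀ y ∈ ball (0 : V) 1, 0 ≤ F y := fun y hy =>
    mul_nonneg (by positivity) (sub_nonneg.2 (rpow_imageForm_le hm hd (hx.trans hr.le)
      (mem_ball_zero_iff.1 hy).le))
  set κ : ℝ := 4 * m * δ ^ 2 * ((2 * δ ^ 2) ^ (-m - 1) / 2)
  have hκ0 : 0 ≤ κ := by positivity
  have hκ : ∀ y ∈ ball x δ, κ * G ≤ F y * g y := fun y hy => by
    have h1 : κ ≤ F y := by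
      refine mul_le_mul_of_nonneg_left (half_rpow_le_sub hm hd hr hδr hx (hxr y hy).1 ?_)
        (by positivity)
      rw [mem_ball_iff_norm, norm_sub_rev] at hy
      exact pow_le_pow_left₀ (norm_nonneg _) hy.le 2
    have h2 := hg0 y (hsub hy)
    calc κ * G ≤ κ * g y := mul_le_mul_of_nonneg_left (hxr y hy).2 hκ0
      _ ≤ F y * g y := mul_le_mul_of_nonneg_right h1 h2
  have hvol : μ.real (ball x δ) = δ ^ Module.finrank ℝ V * μ.real (ball 0 1) := by
    rw [measureReal_def, Measure.addHaar_ball_of_pos μ x hδ, ENNReal.toReal_mul,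
      ENNReal.toReal_ofReal (by positivity), measureReal_def]
  have hpow : δ ^ Module.finrank ℝ V = (δ ^ 2) ^ m := by
    rw [← Real.rpow_natCast, ← Real.rpow_natCast, ← Real.rpow_mul hδ.le, ← hmV]
    norm_num
  have hone : (δ ^ 2) ^ (-m - 1) * δ ^ 2 * (δ ^ 2) ^ m = 1 := by
    rw [← Real.rpow_add_one hd.ne', ← Real.rpow_add hd]
    simp
  calc 2 * m * 2 ^ (-m - 1) * μ.real (ball 0 1) * G
      = μ.real (ball x δ) * (κ * G) := by
        rw [hvol, hpow]
        simp only [κ]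
        rw [Real.mul_rpow (by norm_num) hd.le]
        linear_combination (-2 * m * 2 ^ (-m - 1) * μ.real (ball 0 1) * G) * hone
    _ = ∫ y in ball x δ, κ * G ∂μ := by rw [setIntegral_const, smul_eq_mul]
    _ ≤ ∫ y in ball x δ, F y * g y ∂μ :=
        setIntegral_mono_on (integrableOn_const measure_ball_lt_top.ne) (hFI.mono_set hsub)
          measurableSet_ball hκ
    _ ≤ ∫ y in ball 0 1, F y * g y ∂μ :=
        setIntegral_mono_set hFI ((ae_restrict_iff' measurableSet_ball).2
          (Filter.Eventually.of_forall fun y hy => mul_nonneg (hF0 y hy) (hg0 y hy)))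
          hsub.eventuallyLE

end BallEstimates

/-- A subsolution of `-Δu + a u ≤ g` on the unit ball with nonpositive boundary values is dominated,
up to an arbitrarily small error, by a multiple of a regularised Green potential of `g`. -/
theorem le_potential_add_of_subsolution {N : ℕ} (hN : 2 ≤ N)
    {a g u : EuclideanSpace ℝ (Fin N) → ℝ}
    (ha : ∀ x ∈ ball (0 : EuclideanSpace ℝ (Fin N)) 1, 0 ≤ a x)
    (hg : ContinuousOn g (ball 0 1)) (hg0 : ∀ x ∈ ball (0 : EuclideanSpace ℝ (Fin N)) 1, 0 ≤ g x)
    (hgI : IntegrableOn g (ball 0 1)) (hu : ContDiffOn ℝ 2 u (ball 0 1))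
    (huc : ContinuousOn u (closedBall 0 1))
    (hu0 : ∀ x ∈ sphere (0 : EuclideanSpace ℝ (Fin N)) 1, u x ≤ 0)
    (hsub : ∀ x ∈ ball (0 : EuclideanSpace ℝ (Fin N)) 1, -lap u x + a x * u x ≤ g x)
    {x : EuclideanSpace ℝ (Fin N)} (hx : ‖x‖ < 1) {ε : ℝ} (hε : 0 < ε) :
    ∃ d > 0, u x ≤ (N * 2 ^ (-(N / 2 : ℝ) - 1) *
      volume.real (ball (0 : EuclideanSpace ℝ (Fin N)) 1))⁻¹ *
        (∫ y in ball 0 1, greenKernel (N / 2) d x y * g y) + 2 * ε := by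
  have hN' : (2 : ℝ) ≤ N := by exact_mod_cast hN
  set m : ℝ := N / 2 with hm
  have hmN : 2 * m = N := by rw [hm]; ring
  set c : ℝ := N * 2 ^ (-m - 1) * volume.real (ball (0 : EuclideanSpace ℝ (Fin N)) 1) with hc
  have hvol : 0 < volume.real (ball (0 : EuclideanSpace ℝ (Fin N)) 1) :=
    ENNReal.toReal_pos (measure_ball_pos _ _ one_pos).ne' measure_ball_lt_top.ne
  have hc0 : 0 < c := by positivity
  obtain ⟨s, hxs, hs0, hs1, hus⟩ := exists_le_of_continuousOn_closedBall huc hu0 hε hx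
  set r : ℝ := (1 + s) / 2 with hr
  have hr1 : r < 1 := by rw [hr]; linarith
  have hr0 : 0 < r := by rw [hr]; linarith
  obtain ⟨η, hη, hgη⟩ := Metric.uniformContinuousOn_iff.1
    ((isCompact_closedBall (0 : EuclideanSpace ℝ (Fin N)) r).uniformContinuousOn_of_continuous
      (hg.mono (closedBall_subset_ball hr1))) ε hε
  have hr2 : 0 < 1 - r ^ 2 := by nlinarith
  set δ : ℝ := min η (min ((1 - s) / 2) ((1 - r ^ 2) / 2))
  have hδ : 0 < δ := lt_min hη (lt_min (by linarith) (by linarith))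
  have hδη : δ ≤ η := min_le_left _ _
  have hδs : δ ≤ (1 - s) / 2 := (min_le_right _ _).trans (min_le_left _ _)
  have hδr : δ ≤ (1 - r ^ 2) / 2 := (min_le_right _ _).trans (min_le_right _ _)
  refine ⟨δ ^ 2, by positivity, ?_⟩
  have hd : 0 < δ ^ 2 := by positivity
  set w : EuclideanSpace ℝ (Fin N) → ℝ := fun z =>
    ∫ y in ball 0 1, greenKernel m (δ ^ 2) z y * g y
  have hw0 : ∀ z, ‖z‖ ≤ 1 → 0 ≤ w z := fun z hz => integral_greenKernel_nonneg m hd hg0 hz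
  have hwc : Continuous w := continuous_integral_mul (isCompact_closedBall 0 1)
    ae_restrict_ball_mem_closedBall hgI (continuous_greenKernel m hd)
  set ψ : EuclideanSpace ℝ (Fin N) → ℝ := fun z => (u z + -c⁻¹ * w z) + ε * ‖z‖ ^ 2 with hψ
  have hψc : ContinuousOn ψ (closedBall 0 s) :=
    ((huc.mono (closedBall_subset_closedBall hs1.le)).add
      (continuous_const.mul hwc).continuousOn).add (by fun_prop)
  obtain ⟨z, hz, hmax⟩ := (isCompact_closedBall (0 : EuclideanSpace ℝ (Fin N)) s).exists_isMaxOn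
    ⟨0, mem_closedBall_self hs0.le⟩ hψc
  have hzs : ‖z‖ ≤ s := mem_closedBall_zero_iff.1 hz
  have hzB : z ∈ ball (0 : EuclideanSpace ℝ (Fin N)) 1 :=
    mem_ball_zero_iff.2 (hzs.trans_lt hs1)
  have hcw : 0 ≤ c⁻¹ * w z := mul_nonneg (inv_pos.2 hc0).le (hw0 z (hzs.trans hs1.le))
  have hεz : ε * ‖z‖ ^ 2 ≤ ε :=
    mul_le_of_le_one_right hε.le (pow_le_one₀ (norm_nonneg _) (hzs.trans hs1.le))
  have hψz : ψ z ≤ 2 * ε := by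
    by_contra! hlt
    have huz : ε < u z := by
      simp only [hψ] at hlt
      linarith
    have hzs' : ‖z‖ < s := by
      by_contra! hle
      exact huz.not_ge (hus z (ball_subset_closedBall hzB) hle)
    have hloc : IsLocalMax ψ z := hmax.isLocalMax
      (Filter.mem_of_superset (isOpen_ball.mem_nhds (mem_ball_zero_iff.2 hzs'))
        ball_subset_closedBall)
    have hb : ⇑(EuclideanSpace.basisFun (Fin N) ℝ) = fun i => EuclideanSpace.single i (1 : ℝ) :=
      funext fun i => EuclideanSpace.basisFun_apply _ _ i
    have hLu := hasLaplacianAlong_lap (hu.contDiffAt (isOpen_ball.mem_nhds hzB))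
    rw [← hb] at hLu
    have hLw := hasLaplacianAlong_integral_greenKernel (isCompact_closedBall 0 1)
      ae_restrict_ball_mem_closedBall hgI (EuclideanSpace.basisFun (Fin N) ℝ) hd (m := m)
      (by simpa using hmN) z
    have hL := ((hLu.add (hLw.const_mul (-c⁻¹))).add
      ((hasLaplacianAlong_norm_sq (EuclideanSpace.basisFun (Fin N) ℝ) z).const_mul
        ε)).nonpos_of_isLocalMax hloc
    have hlow := le_integral_directForm_sub_imageForm (m := m) (G := g z - ε)
      (μ := (volume : Measure (EuclideanSpace ℝ (Fin N)))) (by positivity)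
      (by simpa using hmN) hr1 hδ (by nlinarith) hgI hg0 (x := z)
      (by rw [hr]; linarith) (fun y hy => by
        rw [mem_ball] at hy
        have hyr : ‖y‖ ≤ r := by
          have h1 : ‖y‖ ≤ ‖z‖ + ‖y - z‖ := norm_le_norm_add_norm_sub' y z
          rw [dist_eq_norm] at hy
          rw [hr]
          linarith
        refine ⟨hyr, ?_⟩
        have h2 := hgη y (mem_closedBall_zero_iff.2 hyr) z
          (mem_closedBall_zero_iff.2 (by rw [hr]; linarith)) (hy.trans_le hδη)
        rw [Real.dist_eq] at h2
        linarith [(abs_lt.1 h2).1])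
    rw [hmN, ← hc] at hlow
    have h3 := mul_le_mul_of_nonneg_left hlow (inv_pos.2 hc0).le
    rw [inv_mul_cancel_left₀ hc0.ne'] at h3
    have h4 := hsub z hzB
    have h5 : 0 ≤ a z * u z := mul_nonneg (ha z hzB) (hε.trans huz).le
    rw [Fintype.card_fin, neg_mul_neg] at hL
    nlinarith
  have hψx : ψ x ≤ ψ z := hmax (mem_closedBall_zero_iff.2 hxs)
  have h6 : 0 ≤ ε * ‖x‖ ^ 2 := by positivity
  change u x ≤ c⁻¹ * w x + 2 * ε
  simp only [hψ] at hψx hψz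
  linarith

/-- Lemma 3.9 of the paper on the unit ball: subsolutions of `-Δu + a u ≤ g`,
`g ≥ 0`, `g ∈ L^p`, `p > N`, with `u ≤ 0` on the boundary, satisfy
`u(x) ≤ C ‖g‖_{L^p} dist(x, ∂ω)`. -/
theorem stmt_11 {N : ℕ} (hN : 2 ≤ N) (K : ℝ) (hK : 0 ≤ K) (p : ℝ) (hp : (N : ℝ) < p) :
    ∃ C : ℝ, 0 < C ∧
      ∀ a g u : EuclideanSpace ℝ (Fin N) → ℝ,
        ContinuousOn a (ball (0 : EuclideanSpace ℝ (Fin N)) 1) →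
        (∀ x ∈ ball (0 : EuclideanSpace ℝ (Fin N)) 1, 0 ≤ a x ∧ a x ≤ K) →
        ContinuousOn g (ball (0 : EuclideanSpace ℝ (Fin N)) 1) →
        (∀ x ∈ ball (0 : EuclideanSpace ℝ (Fin N)) 1, 0 ≤ g x) →
        IntegrableOn (fun x => g x ^ p) (ball (0 : EuclideanSpace ℝ (Fin N)) 1) →
        ContDiffOn ℝ 2 u (ball (0 : EuclideanSpace ℝ (Fin N)) 1) →
        ContinuousOn u (closedBall (0 : EuclideanSpace ℝ (Fin N)) 1) →
        (∀ x ∈ sphere (0 : EuclideanSpace ℝ (Fin N)) 1, u x ≤ 0) →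
        (∀ x ∈ ball (0 : EuclideanSpace ℝ (Fin N)) 1, -lap u x + a x * u x ≤ g x) →
        ∀ x ∈ ball (0 : EuclideanSpace ℝ (Fin N)) 1,
          u x ≤ C * (∫ y in ball (0 : EuclideanSpace ℝ (Fin N)) 1, g y ^ p) ^ (1 / p) *
            (1 - ‖x‖) := by
  have hN' : (2 : ℝ) ≤ N := by exact_mod_cast hN
  have hp1 : 1 < p := by linarith
  obtain ⟨q, hpq⟩ : ∃ q, p.HolderConjugate q := ⟨_, Real.HolderConjugate.conjExponent hp1⟩
  have : Nontrivial (EuclideanSpace ℝ (Fin N)) := by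
    have : Nonempty (Fin N) := ⟨⟨0, by omega⟩⟩
    infer_instance
  have hdim : ((Module.finrank ℝ (EuclideanSpace ℝ (Fin N)) : ℕ) : ℝ) = N := by simp
  have hm : 2 * ((N : ℝ) / 2) - 1 = N - 1 := by ring
  have hk : (2 * ((N : ℝ) / 2) - 1) * q < Module.finrank ℝ (EuclideanSpace ℝ (Fin N)) := by
    rw [hdim, hm, hpq.conjugate_eq, mul_div_assoc', div_lt_iff₀ (by linarith)]
    linarith
  set J : ℝ := (∫ z in ball (0 : EuclideanSpace ℝ (Fin N)) 2,
    ‖z‖ ^ (-((2 * ((N : ℝ) / 2) - 1) * q))) ^ (1 / q)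
  set c : ℝ := N * 2 ^ (-(N / 2 : ℝ) - 1) *
    volume.real (ball (0 : EuclideanSpace ℝ (Fin N)) 1)
  have hJ : 0 ≤ J :=
    Real.rpow_nonneg (integral_nonneg fun z => Real.rpow_nonneg (norm_nonneg z) _) _
  have hc : 0 ≤ c⁻¹ := by positivity
  refine ⟨c⁻¹ * (8 * J) + 1, by positivity, ?_⟩
  intro a g u _ ha hg hg0 hgp hu huc hu0 hsub x hx
  have hx1 : ‖x‖ < 1 := mem_ball_zero_iff.1 hx
  have hgI : IntegrableOn g (ball 0 1) := by
    have : IsFiniteMeasure (volume.restrict (ball (0 : EuclideanSpace ℝ (Fin N)) 1)) :=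
      ⟨by simpa using measure_ball_lt_top⟩
    exact (memLp_of_continuousOn_of_integrableOn_rpow measurableSet_ball hpq.pos hg hg0
      hgp).integrable (by simpa using hp1.le)
  obtain ⟨hI, hle⟩ := integral_norm_sub_rpow_mul_le hpq hk hg hg0 hgp hx1.le
  set A : ℝ := (∫ y in ball (0 : EuclideanSpace ℝ (Fin N)) 1, g y ^ p) ^ (1 / p)
  have hA : 0 ≤ A := Real.rpow_nonneg (setIntegral_nonneg measurableSet_ball fun y hy =>
    Real.rpow_nonneg (hg0 y hy) _) _
  refine le_of_forall_pos_le_add fun ε hε => ?_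
  obtain ⟨d, hd, hux⟩ := le_potential_add_of_subsolution hN (fun y hy => (ha y hy).1) hg hg0 hgI
    hu huc hu0 hsub hx1 (half_pos hε)
  have hw := integral_greenKernel_le (by linarith : 1 / 2 ≤ (N : ℝ) / 2) hd hgI hg0 hx1 hI
  have hx2 : 0 ≤ 1 - ‖x‖ := by linarith
  have hw' := hw.trans (mul_le_mul_of_nonneg_left hle (by linarith : 0 ≤ 8 * (1 - ‖x‖)))
  have h1 := mul_le_mul_of_nonneg_left hw' hc
  have h2 : 0 ≤ A * (1 - ‖x‖) := mul_nonneg hA hx2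
  calc u x ≤ c⁻¹ * (8 * (1 - ‖x‖) * (J * A)) + 2 * (ε / 2) := hux.trans (by gcongr)
    _ ≤ c⁻¹ * (8 * (1 - ‖x‖) * (J * A)) + A * (1 - ‖x‖) + ε := by linarith
    _ = (c⁻¹ * (8 * J) + 1) * A * (1 - ‖x‖) + ε := by ring
end

section
/- Let N ≥ 2, let ω = B₁(0) ⊂ ℝ^N be the open unit ball, let K ≥ 0, and let y ∈ ω and R > 0 with B_{2R}(y) ⊂ ω. There exists C > 0, depending only on N, K, y and R, such that: for every continuous a : ω → ℝ with 0 ≤ a ≤ K, every continuous nonnegative integrable f : ω → ℝ, and every function u ∈ C²(ω) ∩ C(cl(ω)) with u ≥ 0 on ∂ω and −Δu(x) + a(x)u(x) ≥ f(x) for all x ∈ ω, one has u(x) ≥ C·(1−|x|)·∫_{B_R(y)} f(z) dz for all x ∈ ω. -/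
open MeasureTheory Metric Set

open Filter Topology

section Laplacian

variable {N : ℕ} {u v : EuclideanSpace ℝ (Fin N) → ℝ} {x : EuclideanSpace ℝ (Fin N)}

open InnerProductSpace Laplacian in
lemma lap_eq_laplacian (hu : ContDiffAt ℝ 2 u x) : lap u x = Δ u x := by
  rw [laplacian_eq_iteratedFDeriv_orthonormalBasis u (EuclideanSpace.basisFun (Fin N) ℝ)]
  refine Finset.sum_congr rfl fun i _ => ?_
  have h : DifferentiableAt ℝ (fderiv ℝ u) x :=
    (hu.fderiv_right (m := 1) (by norm_num)).differentiableAt (by norm_num)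
  rw [iteratedFDeriv_two_apply, fderiv_clm_apply h (differentiableAt_const _)]
  simp

lemma lap_add (hu : ContDiffAt ℝ 2 u x) (hv : ContDiffAt ℝ 2 v x) :
    lap (fun z => u z + v z) x = lap u x + lap v x := by
  rw [lap_eq_laplacian (hu.add hv), lap_eq_laplacian hu, lap_eq_laplacian hv]
  exact hu.laplacian_add hv

lemma lap_const_mul (c : ℝ) (hu : ContDiffAt ℝ 2 u x) :
    lap (fun z => c * u z) x = c * lap u x := by
  rw [lap_eq_laplacian (contDiffAt_const.mul hu), lap_eq_laplacian hu]
  exact InnerProductSpace.laplacian_smul c hu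

lemma lap_congr (h : u =ᶠ[𝓝 x] v) : lap u x = lap v x := by
  refine Finset.sum_congr rfl fun i _ => ?_
  have : (fun y => fderiv ℝ u y (EuclideanSpace.single i 1)) =ᶠ[𝓝 x]
      fun y => fderiv ℝ v y (EuclideanSpace.single i 1) :=
    h.eventuallyEq_nhds.mono fun y hy => by simp only [hy.fderiv_eq]
  rw [this.fderiv_eq]

lemma contDiff_fderiv_single (hu : ContDiff ℝ 2 u) (i : Fin N) :
    ContDiff ℝ 1 fun y => fderiv ℝ u y (EuclideanSpace.single i 1) :=
  (hu.fderiv_right (m := 1) (by norm_num)).clm_apply contDiff_const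

lemma continuous_lap (hu : ContDiff ℝ 2 u) : Continuous (lap u) :=
  continuous_finsetSum _ fun i _ =>
    ((contDiff_fderiv_single hu i).continuous_fderiv one_ne_zero).clm_apply continuous_const

lemma fderiv_one_sub_norm_sq (x e : EuclideanSpace ℝ (Fin N)) :
    fderiv ℝ (fun z : EuclideanSpace ℝ (Fin N) => 1 - ‖z‖ ^ 2) x e = -2 * inner ℝ x e := by
  have := ((hasStrictFDerivAt_norm_sq x).hasFDerivAt.const_sub 1).fderiv
  rw [this]
  simp

lemma lap_one_sub_norm_sq (x : EuclideanSpace ℝ (Fin N)) :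
    lap (fun z : EuclideanSpace ℝ (Fin N) => 1 - ‖z‖ ^ 2) x = -2 * N := by
  simp only [lap, fderiv_one_sub_norm_sq]
  have (i : Fin N) : fderiv ℝ (fun y : EuclideanSpace ℝ (Fin N) =>
      -2 * inner ℝ y (EuclideanSpace.single i (1 : ℝ))) x (EuclideanSpace.single i 1) = -2 := by
    have hd : DifferentiableAt ℝ (fun y : EuclideanSpace ℝ (Fin N) =>
        inner ℝ y (EuclideanSpace.single i (1 : ℝ))) x :=
      differentiableAt_id.inner ℝ (differentiableAt_const _)
    rw [fderiv_const_mul hd, smul_apply,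
      fderiv_inner_apply ℝ differentiableAt_fun_id (differentiableAt_const _)]
    simp
  rw [Finset.sum_congr rfl fun i _ => this i]
  simp [mul_comm]

lemma lap_exp_sub_one (hu : ContDiff ℝ 2 u) (α : ℝ) (x : EuclideanSpace ℝ (Fin N)) :
    lap (fun z => Real.exp (α * u z) - 1) x = α * Real.exp (α * u x) *
      (lap u x + α * ∑ i, (fderiv ℝ u x (EuclideanSpace.single i 1)) ^ 2) := by
  have hd : Differentiable ℝ u := hu.differentiable (by norm_num)
  have h1 (y e : EuclideanSpace ℝ (Fin N)) : fderiv ℝ (fun z => Real.exp (α * u z) - 1) y e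
      = α * Real.exp (α * u y) * fderiv ℝ u y e := by
    have := (((hd y).hasFDerivAt.const_mul α).exp.sub_const 1).fderiv
    rw [this]
    simp
    ring
  simp only [lap, h1, Finset.mul_sum, ← Finset.sum_add_distrib]
  refine Finset.sum_congr rfl fun i _ => ?_
  have h2 : DifferentiableAt ℝ (fun y => fderiv ℝ u y (EuclideanSpace.single i 1)) x :=
    (contDiff_fderiv_single hu i).differentiable one_ne_zero x
  have := ((((hd x).hasFDerivAt.const_mul α).exp.const_mul α).mul h2.hasFDerivAt).fderiv
  erw [this]
  simp
  ring

lemma IsLocalMin.deriv_deriv_nonneg {φ : ℝ → ℝ} {t : ℝ} (h : IsLocalMin φ t)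
    (hc : ContinuousAt φ t) : 0 ≤ deriv (deriv φ) t := by
  by_contra! hlt
  have hmax := isLocalMax_of_deriv_deriv_neg hlt h.deriv_eq_zero hc
  have heq : φ =ᶠ[𝓝 t] fun _ => φ t := by
    filter_upwards [h, hmax] with s hs hs' using le_antisymm hs' hs
  have : deriv (deriv φ) t = deriv (deriv fun _ => φ t) t := heq.deriv.deriv_eq
  simp at this
  linarith

lemma IsLocalMin.lap_nonneg (h : IsLocalMin u x) (hu : ContDiffAt ℝ 2 u x) : 0 ≤ lap u x := by
  refine Finset.sum_nonneg fun i _ => ?_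
  set e : EuclideanSpace ℝ (Fin N) := EuclideanSpace.single i 1
  have hline (t : ℝ) : HasDerivAt (fun s : ℝ => x + s • e) e t := by
    simpa using ((hasDerivAt_id t).smul_const e).const_add x
  have hx0 : x + (0 : ℝ) • e = x := by simp
  have htend : Tendsto (fun s : ℝ => x + s • e) (𝓝 0) (𝓝 x) := by
    simpa using (hline 0).continuousAt.tendsto
  have hdiff : ∀ᶠ z in 𝓝 x, DifferentiableAt ℝ u z :=
    (hu.eventually (by simp)).mono fun z hz => hz.differentiableAt (by norm_num)
  have h1 : deriv (fun s : ℝ => u (x + s • e)) =ᶠ[𝓝 0] fun s => fderiv ℝ u (x + s • e) e := by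
    filter_upwards [htend.eventually hdiff] with s hs
    exact (hs.hasFDerivAt.comp_hasDerivAt s (hline s)).deriv
  have h2 : DifferentiableAt ℝ (fun y => fderiv ℝ u y e) x :=
    ((hu.fderiv_right (m := 1) (by norm_num)).clm_apply contDiffAt_const).differentiableAt
      one_ne_zero
  have h3 : HasDerivAt (fun s : ℝ => fderiv ℝ u (x + s • e) e)
      (fderiv ℝ (fun y => fderiv ℝ u y e) x e) 0 :=
    HasFDerivAt.comp_hasDerivAt (l := fun y => fderiv ℝ u y e) (0 : ℝ)
      (by rw [hx0]; exact h2.hasFDerivAt) (hline 0)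
  rw [← h3.deriv, ← h1.deriv_eq]
  refine IsLocalMin.deriv_deriv_nonneg ?_ ?_
  · have := htend.eventually h
    simpa [IsLocalMin, IsMinFilter] using this
  · exact ContinuousAt.comp (g := u) (by rw [hx0]; exact hu.continuousAt) (hline 0).continuousAt

/-- Weak minimum principle for `-Δ + a` with `0 ≤ a`. -/
lemma nonneg_of_supersolution (hN : 0 < N) {S U : Set (EuclideanSpace ℝ (Fin N))}
    {a : EuclideanSpace ℝ (Fin N) → ℝ} (hS : IsCompact S) (hS1 : S ⊆ closedBall 0 1)
    (hU : IsOpen U) (hUS : U ⊆ S) (hu : ContinuousOn u S) (hu2 : ContDiffOn ℝ 2 u U)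
    (hbd : ∀ z ∈ S \ U, 0 ≤ u z) (ha : ∀ z ∈ U, 0 ≤ a z)
    (hsuper : ∀ z ∈ U, 0 ≤ -lap u z + a z * u z) (hx : x ∈ S) : 0 ≤ u x := by
  have hq : ∀ z ∈ S, 0 ≤ 1 - ‖z‖ ^ 2 := fun z hz => by
    have : ‖z‖ ≤ 1 := by simpa using hS1 hz
    nlinarith [norm_nonneg z]
  have hqc : ContDiff ℝ 2 fun z : EuclideanSpace ℝ (Fin N) => 1 - ‖z‖ ^ 2 :=
    contDiff_const.sub (contDiff_norm_sq ℝ)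
  have key (ε : ℝ) (hε : 0 < ε) : 0 ≤ u x + ε * (1 - ‖x‖ ^ 2) := by
    obtain ⟨p, hp, hmin⟩ := hS.exists_isMinOn ⟨x, hx⟩
      (hu.add (continuous_const.mul hqc.continuous :
        Continuous fun z => ε * (1 - ‖z‖ ^ 2)).continuousOn)
    have hmin' : ∀ z ∈ S, u p + ε * (1 - ‖p‖ ^ 2) ≤ u z + ε * (1 - ‖z‖ ^ 2) := hmin
    refine le_trans ?_ (hmin' x hx)
    by_cases hpU : p ∈ U
    · by_contra! hneg
      have hup : ContDiffAt ℝ 2 u p := hu2.contDiffAt (hU.mem_nhds hpU)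
      have hqp : ContDiffAt ℝ 2 (fun z : EuclideanSpace ℝ (Fin N) => ε * (1 - ‖z‖ ^ 2)) p :=
        (contDiff_const.mul hqc).contDiffAt
      have hloc : IsLocalMin (fun z => u z + ε * (1 - ‖z‖ ^ 2)) p := by
        filter_upwards [hU.mem_nhds hpU] with z hz using hmin' z (hUS hz)
      have hl := hloc.lap_nonneg (hup.add hqp)
      rw [lap_add hup hqp, lap_const_mul ε hqc.contDiffAt, lap_one_sub_norm_sq] at hl
      have h1 := hsuper p hpU
      have h2 : a p * u p ≤ 0 :=
        mul_nonpos_of_nonneg_of_nonpos (ha p hpU) (by nlinarith [hq p hp])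
      have h3 : 0 < ε * (2 * N) := by positivity
      linarith
    · have := hbd p ⟨hp, hpU⟩
      nlinarith [hq p hp]
  by_contra! hneg
  have hx1 : 1 - ‖x‖ ^ 2 ≤ 1 := by nlinarith [sq_nonneg ‖x‖]
  have := key (-u x / 2) (by linarith)
  nlinarith

end Laplacian

section Kernel

lemma hasDerivAt_max_zero_sq (s : ℝ) :
    HasDerivAt (fun s : ℝ => max s 0 ^ 2) (2 * max s 0) s := by
  rcases lt_trichotomy s 0 with h | rfl | h
  · rw [max_eq_right h.le, mul_zero]
    refine (hasDerivAt_const s (0 : ℝ)).congr_of_eventuallyEq ?_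
    filter_upwards [gt_mem_nhds h] with t ht
    simp [max_eq_right (le_of_lt ht)]
  · rw [max_self, mul_zero, hasDerivAt_iff_isLittleO_nhds_zero]
    refine Asymptotics.IsBigO.trans_isLittleO (g := fun t : ℝ => t ^ 2) ?_ ?_
    · refine Asymptotics.IsBigO.of_bound 1 (Eventually.of_forall fun t => ?_)
      rcases le_total t 0 with ht | ht <;> simp [ht, sq_nonneg]
    · simpa using Asymptotics.isLittleO_pow_id (𝕜 := ℝ) one_lt_two
  · rw [max_eq_left h.le]
    refine HasDerivAt.congr_of_eventuallyEq (by simpa using hasDerivAt_pow 2 s) ?_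
    filter_upwards [lt_mem_nhds h] with t ht
    rw [max_eq_left (le_of_lt ht)]

/-- The truncated paraboloid `(r² - |z|²)₊`. -/
noncomputable def paraboloid {N : ℕ} (r : ℝ) (z : EuclideanSpace ℝ (Fin N)) : ℝ :=
  max (r ^ 2 - ‖z‖ ^ 2) 0

variable {N : ℕ} {r : ℝ}

lemma continuous_paraboloid : Continuous (paraboloid (N := N) r) := by
  unfold paraboloid
  fun_prop

lemma paraboloid_nonneg (z : EuclideanSpace ℝ (Fin N)) : 0 ≤ paraboloid r z := le_max_right _ _

lemma paraboloid_le (z : EuclideanSpace ℝ (Fin N)) : paraboloid r z ≤ r ^ 2 :=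
  max_le (by nlinarith [sq_nonneg ‖z‖]) (sq_nonneg r)

lemma paraboloid_eq_zero (hr : 0 < r) {z : EuclideanSpace ℝ (Fin N)} (hz : r ≤ ‖z‖) :
    paraboloid r z = 0 :=
  max_eq_right (by nlinarith)

lemma hasCompactSupport_paraboloid (hr : 0 < r) : HasCompactSupport (paraboloid (N := N) r) :=
  HasCompactSupport.intro (isCompact_closedBall 0 r) fun z hz =>
    paraboloid_eq_zero hr (by simpa using (not_le.1 (by simpa using hz)).le)

lemma integrable_mul_paraboloid (hr : 0 < r) {g : EuclideanSpace ℝ (Fin N) → ℝ}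
    (hg : Continuous g) : Integrable fun z => g z * paraboloid r z :=
  (hg.mul continuous_paraboloid).integrable_of_hasCompactSupport
    (hasCompactSupport_paraboloid hr).mul_left

lemma integrable_mul_paraboloid_sq (hr : 0 < r) {g : EuclideanSpace ℝ (Fin N) → ℝ}
    (hg : Continuous g) : Integrable fun z => g z * paraboloid r z ^ 2 := by
  simpa only [mul_assoc, sq, Pi.mul_apply] using
      integrable_mul_paraboloid hr (hg.mul continuous_paraboloid)

lemma hasFDerivAt_paraboloid_sq (z : EuclideanSpace ℝ (Fin N)) :
    HasFDerivAt (fun z => paraboloid r z ^ 2) (-(4 * paraboloid r z) • innerSL ℝ z) z := by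
  have h := (hasDerivAt_max_zero_sq (r ^ 2 - ‖z‖ ^ 2)).comp_hasFDerivAt z
    ((hasStrictFDerivAt_norm_sq z).hasFDerivAt.const_sub (r ^ 2))
  refine h.congr_fderiv ?_
  ext e
  simp [paraboloid]
  ring

lemma integral_fderiv_mul_paraboloid (hr : 0 < r) {g : EuclideanSpace ℝ (Fin N) → ℝ}
    (hg : ContDiff ℝ 1 g) (e : EuclideanSpace ℝ (Fin N)) :
    ∫ z, g z * (inner ℝ z e * paraboloid r z) =
      1 / 4 * ∫ z, fderiv ℝ g z e * paraboloid r z ^ 2 := by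
  have hfd (z : EuclideanSpace ℝ (Fin N)) :
      fderiv ℝ (fun z => paraboloid r z ^ 2) z e = -4 * (inner ℝ z e * paraboloid r z) := by
    rw [hasFDerivAt_paraboloid_sq z |>.fderiv]
    simp
    ring
  have hi : Continuous fun z : EuclideanSpace ℝ (Fin N) => inner ℝ z e :=
    continuous_id.inner continuous_const
  have h := integral_mul_fderiv_eq_neg_fderiv_mul_of_integrable (μ := volume)
    (f := g) (g := fun z => paraboloid r z ^ 2) (v := e)
    (integrable_mul_paraboloid_sq hr
      ((hg.continuous_fderiv one_ne_zero).clm_apply continuous_const))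
    (by
      simp only [hfd]
      have := (integrable_mul_paraboloid hr (hg.continuous.mul hi)).const_mul (-4)
      refine this.congr (Eventually.of_forall fun z => ?_)
      simp only [Pi.mul_apply]
      ring)
    (integrable_mul_paraboloid_sq hr hg.continuous)
    (fun z _ => hg.differentiable one_ne_zero z)
    (fun z _ => (hasFDerivAt_paraboloid_sq z).differentiableAt)
  simp only [hfd] at h
  have h2 : ∫ z, g z * (-4 * (inner ℝ z e * paraboloid r z)) =
      -4 * ∫ z, g z * (inner ℝ z e * paraboloid r z) := by
    rw [← integral_const_mul]
    congr 1 with z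
    ring
  rw [h2] at h
  linarith

variable {v : EuclideanSpace ℝ (Fin N) → ℝ}

lemma hasDerivAt_integral_paraboloid (hr : 0 < r) (hv : ContDiff ℝ 2 v)
    (hc : HasCompactSupport v) (x : EuclideanSpace ℝ (Fin N)) (t : ℝ) :
    HasDerivAt (fun t : ℝ => ∫ z, v (x + t • z) * paraboloid r z)
      (t / 4 * ∫ z, lap v (x + t • z) * paraboloid r z ^ 2) t := by
  have hv1 : Continuous (fderiv ℝ v) := hv.continuous_fderiv (by norm_num)
  have hvd : Differentiable ℝ v := hv.differentiable (by norm_num)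
  obtain ⟨B, hB⟩ := hv1.bounded_above_of_compact_support (hc.fderiv ℝ)
  have hcont (s : ℝ) : Continuous fun z : EuclideanSpace ℝ (Fin N) => x + s • z := by fun_prop
  have hF' : Continuous fun z => fderiv ℝ v (x + t • z) z :=
    (hv1.comp (hcont t)).clm_apply continuous_id
  have hder := (hasDerivAt_integral_of_dominated_loc_of_deriv_le (μ := volume) (s := univ)
    (F := fun (t : ℝ) z => v (x + t • z) * paraboloid r z) (x₀ := t)
    (F' := fun t z => fderiv ℝ v (x + t • z) z * paraboloid r z)
    (bound := fun z => B * ‖z‖ * paraboloid r z) univ_mem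
    (Eventually.of_forall fun s =>
      (integrable_mul_paraboloid hr (hv.continuous.comp (hcont s))).aestronglyMeasurable)
    (integrable_mul_paraboloid hr (hv.continuous.comp (hcont t)))
    (integrable_mul_paraboloid hr hF').aestronglyMeasurable
    (Eventually.of_forall fun z s _ => by
      rw [norm_mul, Real.norm_of_nonneg (paraboloid_nonneg z)]
      refine mul_le_mul_of_nonneg_right ?_ (paraboloid_nonneg z)
      exact (ContinuousLinearMap.le_opNorm _ _).trans
        (mul_le_mul_of_nonneg_right (hB _) (norm_nonneg _)))
    (integrable_mul_paraboloid hr (continuous_const.mul continuous_norm))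
    (Eventually.of_forall fun z s _ => by
      have h1 : HasDerivAt (fun s : ℝ => x + s • z) z s := by
        simpa using ((hasDerivAt_id s).smul_const z).const_add x
      exact ((hvd _).hasFDerivAt.comp_hasDerivAt s h1).mul_const _)).2
  refine hder.congr_deriv ?_
  let e (i : Fin N) : EuclideanSpace ℝ (Fin N) := EuclideanSpace.single i 1
  let g (i : Fin N) (z : EuclideanSpace ℝ (Fin N)) : ℝ := fderiv ℝ v (x + t • z) (e i)
  have haff : ContDiff ℝ 1 fun z : EuclideanSpace ℝ (Fin N) => x + t • z := by fun_prop
  have hg (i : Fin N) : ContDiff ℝ 1 (g i) := (contDiff_fderiv_single hv i).comp haff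
  have hgd (i : Fin N) (z : EuclideanSpace ℝ (Fin N)) : fderiv ℝ (g i) z (e i) =
      t * fderiv ℝ (fun y => fderiv ℝ v y (e i)) (x + t • z) (e i) := by
    have h1 : HasFDerivAt (fun z : EuclideanSpace ℝ (Fin N) => x + t • z)
        (t • ContinuousLinearMap.id ℝ _) z := ((hasFDerivAt_id z).const_smul t).const_add x
    have h2 := (((contDiff_fderiv_single hv i).differentiable one_ne_zero
      (x + t • z)).hasFDerivAt.comp z h1).fderiv
    change fderiv ℝ ((fun y => fderiv ℝ v y (e i)) ∘ fun z => x + t • z) z (e i) = _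
    rw [h2]
    simp [e]
  have hexp (z : EuclideanSpace ℝ (Fin N)) : fderiv ℝ v (x + t • z) z * paraboloid r z =
      ∑ i, g i z * (inner ℝ z (e i) * paraboloid r z) := by
    have hz : z = ∑ i, inner ℝ z (e i) • e i := by
      conv_lhs => rw [← (EuclideanSpace.basisFun (Fin N) ℝ).sum_repr' z]
      simp [e, real_inner_comm]
    conv_lhs => enter [1, 2]; rw [hz]
    simp only [map_sum, map_smul, smul_eq_mul, Finset.sum_mul, g]
    exact Finset.sum_congr rfl fun i _ => by ring
  have hi (i : Fin N) : Continuous fun z : EuclideanSpace ℝ (Fin N) => inner ℝ z (e i) :=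
    continuous_id.inner continuous_const
  have hint (i : Fin N) : Integrable fun z : EuclideanSpace ℝ (Fin N) =>
      fderiv ℝ (fun y => fderiv ℝ v y (EuclideanSpace.single i 1)) (x + t • z)
        (EuclideanSpace.single i 1) * paraboloid r z ^ 2 :=
    integrable_mul_paraboloid_sq hr
      ((((contDiff_fderiv_single hv i).continuous_fderiv one_ne_zero).comp (hcont t)).clm_apply
        continuous_const)
  rw [integral_congr_ae (Eventually.of_forall hexp)]
  rw [integral_finsetSum _ fun i _ => by
    simpa only [mul_assoc, Pi.mul_apply] using
      integrable_mul_paraboloid hr ((hg i).continuous.mul (hi i))]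
  simp only [integral_fderiv_mul_paraboloid hr (hg _), hgd, lap, Finset.sum_mul]
  rw [integral_finsetSum _ fun i _ => hint i, Finset.mul_sum]
  refine Finset.sum_congr rfl fun i _ => ?_
  simp only [mul_assoc, integral_const_mul]
  ring

end Kernel

section MeanValue

variable {N : ℕ} {K R : ℝ} {v g : EuclideanSpace ℝ (Fin N) → ℝ} {x y : EuclideanSpace ℝ (Fin N)}

lemma add_smul_mem_ball_of_paraboloid_ne_zero {r t : ℝ} (hr : 0 < r) (ht0 : 0 ≤ t) (ht1 : t ≤ 1)
    {z : EuclideanSpace ℝ (Fin N)} (hz : paraboloid r z ≠ 0) : x + t • z ∈ ball x r := by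
  have hz' : ‖z‖ < r := by
    by_contra! h
    exact hz (paraboloid_eq_zero hr h)
  rw [mem_ball, dist_eq_norm, add_sub_cancel_left, norm_smul, Real.norm_of_nonneg ht0]
  nlinarith [norm_nonneg z]

lemma setIntegral_le_integral_paraboloid_sq (hR : 0 < R) (hx : x ∈ closedBall y (R / 4))
    (hg : Continuous g) (hpos : ∀ z ∈ ball x (3 * R / 2), 0 ≤ g z) {t : ℝ}
    (ht0 : 10 / 11 ≤ t) (ht1 : t ≤ 1) :
    (23 / 64 * R ^ 2) ^ 2 * ∫ z in ball y R, g z ≤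
      ∫ z, g (x + t • z) * paraboloid (3 * R / 2) z ^ 2 := by
  have hr : 0 < 3 * R / 2 := by positivity
  have ht : 0 < t := by linarith
  have hsub {w : EuclideanSpace ℝ (Fin N)} (hw : w ∈ ball y R) : dist w x ≤ 5 * R / 4 := by
    have := dist_triangle w y x
    rw [mem_ball] at hw
    rw [mem_closedBall, dist_comm] at hx
    linarith
  have hgB {w : EuclideanSpace ℝ (Fin N)} (hw : w ∈ ball y R) : 0 ≤ g w :=
    hpos w (by rw [mem_ball]; linarith [hsub hw])
  set φ : EuclideanSpace ℝ (Fin N) → ℝ := (ball y R).indicator g with hφ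
  have hφi : Integrable φ := by
    rw [hφ, integrable_indicator_iff measurableSet_ball]
    exact (hg.continuousOn.integrableOn_compact (isCompact_closedBall y R)).mono_set
      ball_subset_closedBall
  have hφ0 : 0 ≤ ∫ z, φ z := integral_nonneg fun z => indicator_nonneg (fun w hw => hgB hw) z
  have hscale : ∫ z in ball y R, g z ≤ ∫ z, φ (x + t • z) := by
    rw [Measure.integral_comp_smul volume (fun z => φ (x + z)), integral_add_left_eq_self φ x,
      ← integral_indicator measurableSet_ball, smul_eq_mul]
    refine le_mul_of_one_le_left hφ0 ?_
    rw [abs_of_pos (by positivity)]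
    exact one_le_inv₀ (by positivity) |>.2 (pow_le_one₀ ht.le ht1)
  refine (mul_le_mul_of_nonneg_left hscale (by positivity)).trans ?_
  rw [← integral_const_mul]
  refine integral_mono (((hφi.comp_add_left x).comp_smul ht.ne').const_mul _)
    (integrable_mul_paraboloid_sq hr (hg.comp (by fun_prop))) fun z => ?_
  simp only
  by_cases hw : x + t • z ∈ ball y R
  · rw [hφ, indicator_of_mem hw, mul_comm]
    refine mul_le_mul_of_nonneg_left ?_ (hgB hw)
    refine pow_le_pow_left₀ (by positivity) (le_max_of_le_left ?_) 2
    have h1 := hsub hw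
    rw [dist_eq_norm, add_sub_cancel_left, norm_smul, Real.norm_of_nonneg ht.le] at h1
    have h2 : ‖z‖ ≤ 11 * R / 8 := by nlinarith [norm_nonneg z]
    nlinarith [norm_nonneg z]
  · rw [hφ, indicator_of_notMem hw, mul_zero]
    by_cases hz : paraboloid (3 * R / 2) z = 0
    · simp [hz]
    · exact mul_nonneg (hpos _ (add_smul_mem_ball_of_paraboloid_ne_zero hr ht.le ht1 hz)) (sq_nonneg _)

lemma setIntegral_le_of_supersolution (hK : 0 ≤ K) (hR : 0 < R) (hx : x ∈ closedBall y (R / 4))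
    (hv : ContDiff ℝ 2 v) (hc : HasCompactSupport v)
    (hpos : ∀ z ∈ ball x (3 * R / 2), 0 ≤ v z)
    (hsuper : ∀ z ∈ ball x (3 * R / 2), 0 ≤ -lap v z + K * v z) :
    1 / 88 * (23 / 64 * R ^ 2) ^ 2 * Real.exp (-(K * (3 * R / 2) ^ 2 / 4)) *
        ∫ z in ball y R, (-lap v z + K * v z) ≤
      (∫ z, paraboloid (N := N) (3 * R / 2) z) * v x := by
  set r := 3 * R / 2 with hr_def
  have hr : 0 < r := by positivity
  set c : ℝ := K * r ^ 2 / 4 with hc_def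
  have hc0 : 0 ≤ c := by positivity
  set M := ∫ z in ball y R, (-lap v z + K * v z) with hM
  have hcont (s : ℝ) : Continuous fun z : EuclideanSpace ℝ (Fin N) => x + s • z := by fun_prop
  have hgc : Continuous fun z => -lap v z + K * v z :=
    (continuous_lap hv).neg.add (continuous_const.mul hv.continuous)
  let F (t : ℝ) : ℝ := ∫ z, v (x + t • z) * paraboloid r z
  let G (t : ℝ) : ℝ := ∫ z, (-lap v (x + t • z) + K * v (x + t • z)) * paraboloid r z ^ 2
  have hM0 : 0 ≤ M := setIntegral_nonneg measurableSet_ball fun w hw => hsuper w (by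
    have := dist_triangle w y x
    rw [mem_ball] at hw ⊢
    rw [mem_closedBall, dist_comm] at hx
    linarith)
  have hF0 {t : ℝ} (h0 : 0 ≤ t) (h1 : t ≤ 1) : 0 ≤ F t := integral_nonneg fun z => by
    by_cases hz : paraboloid r z = 0
    · simp [hz]
    · exact mul_nonneg (hpos _ (add_smul_mem_ball_of_paraboloid_ne_zero hr h0 h1 hz))
        (paraboloid_nonneg z)
  have hG0 {t : ℝ} (h0 : 0 ≤ t) (h1 : t ≤ 1) : 0 ≤ G t := integral_nonneg fun z => by
    by_cases hz : paraboloid r z = 0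
    · simp [hz]
    · exact mul_nonneg (hsuper _ (add_smul_mem_ball_of_paraboloid_ne_zero hr h0 h1 hz)) (sq_nonneg _)
  have hGM {t : ℝ} (h0 : 10 / 11 ≤ t) (h1 : t ≤ 1) : (23 / 64 * R ^ 2) ^ 2 * M ≤ G t :=
    setIntegral_le_integral_paraboloid_sq hR hx hgc hsuper h0 h1
  have hlap {t : ℝ} (h0 : 0 ≤ t) (h1 : t ≤ 1) :
      t / 4 * ∫ z, lap v (x + t • z) * paraboloid r z ^ 2 ≤ c * F t - t / 4 * G t := by
    have e1 : ∫ z, lap v (x + t • z) * paraboloid r z ^ 2 =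
        K * (∫ z, v (x + t • z) * paraboloid r z ^ 2) - G t := by
      rw [← integral_const_mul, ← integral_sub]
      · congr 1 with z
        ring
      · exact (integrable_mul_paraboloid_sq hr (hv.continuous.comp (hcont t))).const_mul K
      · exact integrable_mul_paraboloid_sq hr (hgc.comp (hcont t))
    have e2 : ∫ z, v (x + t • z) * paraboloid r z ^ 2 ≤ r ^ 2 * F t := by
      rw [← integral_const_mul]
      refine integral_mono (integrable_mul_paraboloid_sq hr (hv.continuous.comp (hcont t)))
        ((integrable_mul_paraboloid hr (hv.continuous.comp (hcont t))).const_mul _) fun z => ?_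
      simp only
      by_cases hz : paraboloid r z = 0
      · simp [hz]
      · have h := mul_nonneg (hpos _ (add_smul_mem_ball_of_paraboloid_ne_zero hr h0 h1 hz))
          (paraboloid_nonneg (r := r) z)
        nlinarith [paraboloid_le (r := r) z]
    rw [e1]
    have e3 := mul_le_mul_of_nonneg_left e2 hK
    have e4 := mul_le_mul_of_nonneg_left e3 (by linarith : 0 ≤ t / 4)
    have e5 : t * (c * F t) ≤ c * F t :=
      mul_le_of_le_one_left (mul_nonneg hc0 (hF0 h0 h1)) h1
    have e6 : t / 4 * (K * (r ^ 2 * F t)) = t * (c * F t) := by rw [hc_def]; ring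
    linarith
  let H (t : ℝ) : ℝ := F t * Real.exp (-(c * t))
  have hH (t : ℝ) : HasDerivAt H ((t / 4 * ∫ z, lap v (x + t • z) * paraboloid r z ^ 2) *
      Real.exp (-(c * t)) + F t * (Real.exp (-(c * t)) * -c)) t := by
    refine (hasDerivAt_integral_paraboloid hr hv hc x t).mul ?_
    simpa using ((hasDerivAt_id t).const_mul c).neg.exp
  have hHd {t : ℝ} (h0 : 0 ≤ t) (h1 : t ≤ 1) :
      deriv H t ≤ -(t / 4 * G t) * Real.exp (-(c * t)) := by
    rw [(hH t).deriv]
    nlinarith [hlap h0 h1, Real.exp_pos (-(c * t))]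
  have hdiff : Differentiable ℝ H := fun t => (hH t).differentiableAt
  have hstep1 : H (10 / 11) - H 0 ≤ 0 * (10 / 11 - 0) := by
    refine (convex_Icc (0 : ℝ) 1).image_sub_le_mul_sub_of_deriv_le hdiff.continuous.continuousOn
      hdiff.differentiableOn ?_ _ (by norm_num) _ (by norm_num) (by norm_num)
    intro t ht
    rw [interior_Icc] at ht
    refine (hHd ht.1.le ht.2.le).trans ?_
    have := mul_nonneg ht.1.le (hG0 ht.1.le ht.2.le)
    nlinarith [Real.exp_pos (-(c * t))]
  have hstep2 : H 1 - H (10 / 11) ≤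
      -(1 / 8 * ((23 / 64 * R ^ 2) ^ 2 * M) * Real.exp (-c)) * (1 - 10 / 11) := by
    refine (convex_Icc (10 / 11 : ℝ) 1).image_sub_le_mul_sub_of_deriv_le
      hdiff.continuous.continuousOn hdiff.differentiableOn ?_ _ (by norm_num) _ (by norm_num)
      (by norm_num)
    intro t ht
    rw [interior_Icc] at ht
    have ht0 : 0 ≤ t := by linarith [ht.1]
    refine (hHd ht0 ht.2.le).trans ?_
    rw [neg_mul, neg_le_neg_iff]
    have hG := hGM ht.1.le ht.2.le
    have hGM0 : 0 ≤ (23 / 64 * R ^ 2) ^ 2 * M := by positivity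
    refine mul_le_mul ?_ (Real.exp_le_exp.2 ?_) (Real.exp_pos _).le ?_
    · exact mul_le_mul (by linarith [ht.1]) hG hGM0 (by linarith)
    · nlinarith [ht.2]
    · exact mul_nonneg (by linarith) (hG0 ht0 ht.2.le)
  have hH1 : 0 ≤ H 1 := mul_nonneg (hF0 zero_le_one le_rfl) (Real.exp_pos _).le
  have hH0 : H 0 = (∫ z, paraboloid (N := N) r z) * v x := by
    simp [H, F, integral_const_mul, mul_comm]
  rw [← hH0]
  linarith

end MeanValue

section Barrier

variable {N : ℕ} {K R : ℝ} {u f : EuclideanSpace ℝ (Fin N) → ℝ} {x y : EuclideanSpace ℝ (Fin N)}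

lemma setIntegral_le_of_supersolutionOn (hK : 0 ≤ K) (hR : 0 < R)
    (hx : x ∈ closedBall y (R / 4)) (hu : ContDiffOn ℝ 2 u (ball y (2 * R)))
    (hpos : ∀ z ∈ ball y (2 * R), 0 ≤ u z)
    (hf0 : ∀ z ∈ ball y (2 * R), 0 ≤ f z) (hf : IntegrableOn f (ball y R))
    (hsuper : ∀ z ∈ ball y (2 * R), f z ≤ -lap u z + K * u z) :
    1 / 88 * (23 / 64 * R ^ 2) ^ 2 * Real.exp (-(K * (3 * R / 2) ^ 2 / 4)) *
        ∫ z in ball y R, f z ≤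
      (∫ z, paraboloid (N := N) (3 * R / 2) z) * u x := by
  let b : ContDiffBump y := ⟨7 * R / 4, 15 * R / 8, by positivity, by linarith⟩
  let v : EuclideanSpace ℝ (Fin N) → ℝ := fun z => b z * u z
  have hts : tsupport v ⊆ closedBall y (15 * R / 8) :=
    (tsupport_mul_subset_left (f := b) (g := u)).trans b.tsupport_eq.subset
  have hc : HasCompactSupport v := b.hasCompactSupport.mul_right
  have hv : ContDiff ℝ 2 v := by
    rw [contDiff_iff_contDiffAt]
    intro z
    by_cases hz : z ∈ ball y (2 * R)
    · exact b.contDiffAt.mul (hu.contDiffAt (isOpen_ball.mem_nhds hz))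
    · have hz' : z ∉ tsupport v := fun h => hz (by
        have := hts h
        rw [mem_closedBall] at this
        rw [mem_ball]
        linarith)
      exact contDiffAt_const.congr_of_eventuallyEq (notMem_tsupport_iff_eventuallyEq.1 hz')
  have heq {z : EuclideanSpace ℝ (Fin N)} (hz : z ∈ ball y (7 * R / 4)) : v =ᶠ[𝓝 z] u := by
    filter_upwards [isOpen_ball.mem_nhds hz] with w hw
    simp only [v]
    rw [b.one_of_mem_closedBall (ball_subset_closedBall hw), one_mul]
  have hsub1 : ball y (7 * R / 4) ⊆ ball y (2 * R) := ball_subset_ball (by linarith)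
  have hsub2 : ball x (3 * R / 2) ⊆ ball y (7 * R / 4) :=
    ball_subset_ball' (by rw [mem_closedBall] at hx; linarith)
  have hg {z : EuclideanSpace ℝ (Fin N)} (hz : z ∈ ball y (7 * R / 4)) :
      f z ≤ -lap v z + K * v z := by
    rw [lap_congr (heq hz), (heq hz).self_of_nhds]
    exact hsuper z (hsub1 hz)
  have hxb : x ∈ ball y (7 * R / 4) := by
    rw [mem_closedBall] at hx
    rw [mem_ball]
    linarith
  rw [← (heq hxb).self_of_nhds]
  refine le_trans ?_ (setIntegral_le_of_supersolution hK hR hx hv hc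
    (fun z hz => by
      rw [(heq (hsub2 hz)).self_of_nhds]
      exact hpos z (hsub1 (hsub2 hz)))
    (fun z hz => (hf0 z (hsub1 (hsub2 hz))).trans (hg (hsub2 hz))))
  refine mul_le_mul_of_nonneg_left ?_ (by positivity)
  have hgc : Continuous fun z => -lap v z + K * v z :=
    (continuous_lap hv).neg.add (continuous_const.mul hv.continuous)
  exact setIntegral_mono_on hf ((hgc.continuousOn.integrableOn_compact
    (isCompact_closedBall y R)).mono_set ball_subset_closedBall) measurableSet_ball
    fun z hz => hg (ball_subset_ball (by linarith) hz)

/-- A function positive in the unit ball, vanishing on its boundary, whose only critical point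
in the closed ball is `y`. -/
lemma exists_unique_critical_point (hy : y ∈ ball (0 : EuclideanSpace ℝ (Fin N)) 1) :
    ∃ h : EuclideanSpace ℝ (Fin N) → ℝ, ContDiff ℝ 2 h ∧ (∀ z ∈ sphere 0 1, h z = 0) ∧
      (∃ κ > 0, ∀ z ∈ closedBall 0 1, κ * (1 - ‖z‖) ≤ h z) ∧
      ∀ z ∈ closedBall 0 1, (∀ i, fderiv ℝ h z (EuclideanSpace.single i 1) = 0) → z = y := by
  have hy1 : ‖y‖ < 1 := by simpa using hy
  have hy2 : 0 < 1 - ‖y‖ ^ 2 := by nlinarith [norm_nonneg y]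
  let b : EuclideanSpace ℝ (Fin N) := (2 / (1 - ‖y‖ ^ 2)) • y
  refine ⟨fun z => (1 - ‖z‖ ^ 2) * Real.exp (inner ℝ b z), ?_, ?_, ⟨Real.exp (-‖b‖),
    Real.exp_pos _, ?_⟩, ?_⟩
  · exact (contDiff_const.sub (contDiff_norm_sq ℝ)).mul
      (Real.contDiff_exp.comp (contDiff_const.inner ℝ contDiff_id))
  · intro z hz
    have : ‖z‖ = 1 := by simpa using hz
    simp [this]
  · intro z hz
    have hz1 : ‖z‖ ≤ 1 := by simpa using hz
    rw [mul_comm]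
    refine mul_le_mul (by nlinarith [norm_nonneg z]) (Real.exp_le_exp.2 ?_) (Real.exp_pos _).le
      (by nlinarith [norm_nonneg z])
    have h1 := neg_le_of_abs_le (abs_real_inner_le_norm b z)
    nlinarith [norm_nonneg b]
  · intro z hz hcrit
    have hz1 : ‖z‖ ≤ 1 := by simpa using hz
    have hfd : HasFDerivAt (fun z => (1 - ‖z‖ ^ 2) * Real.exp (inner ℝ b z))
        ((1 - ‖z‖ ^ 2) • (Real.exp (inner ℝ b z) • innerSL ℝ b) +
          Real.exp (inner ℝ b z) • -(2 • innerSL ℝ z)) z :=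
      ((hasStrictFDerivAt_norm_sq z).hasFDerivAt.const_sub 1).mul
        ((innerSL ℝ b).hasFDerivAt.exp)
    have hvec : (1 - ‖z‖ ^ 2) • b = (2 : ℝ) • z := by
      ext i
      have h := hcrit i
      rw [hfd.fderiv] at h
      simp only [add_apply, smul_apply, neg_apply, innerSL_apply_apply, smul_eq_mul,
        EuclideanSpace.inner_single_right, nsmul_eq_mul] at h
      simp at h
      have hexp := Real.exp_pos (inner ℝ b z)
      have : Real.exp (inner ℝ b z) * ((1 - ‖z‖ ^ 2) * b i - 2 * z i) = 0 := by linarith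
      rcases mul_eq_zero.1 this with h | h
      · exact absurd h hexp.ne'
      · simp only [PiLp.smul_apply, smul_eq_mul]
        linarith
    have hz2 : 0 ≤ 1 - ‖z‖ ^ 2 := by nlinarith [norm_nonneg z]
    have hvec' : (1 - ‖z‖ ^ 2) • y = (1 - ‖y‖ ^ 2) • z := by
      have h := congrArg (((1 - ‖y‖ ^ 2) / 2) • ·) hvec
      simp only [b, smul_smul] at h
      convert h using 2 <;> field_simp
    have hn := congrArg norm hvec'
    rw [norm_smul, norm_smul, Real.norm_of_nonneg hz2, Real.norm_of_nonneg hy2.le] at hn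
    have hnorm : ‖z‖ = ‖y‖ := by
      have h1 : (‖y‖ - ‖z‖) * (1 + ‖y‖ * ‖z‖) = 0 := by linarith
      have h2 : 0 < 1 + ‖y‖ * ‖z‖ := by positivity
      rcases mul_eq_zero.1 h1 with h | h <;> linarith
    rw [hnorm] at hvec'
    exact (smul_right_injective _ hy2.ne' hvec').symm

lemma exists_barrier (hK : 0 ≤ K) {ρ : ℝ} (hρ : 0 < ρ)
    (hy : y ∈ ball (0 : EuclideanSpace ℝ (Fin N)) 1) :
    ∃ w : EuclideanSpace ℝ (Fin N) → ℝ, ContDiff ℝ 2 w ∧ (∀ z ∈ sphere 0 1, w z = 0) ∧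
      (∃ κ > 0, ∀ z ∈ closedBall 0 1, κ * (1 - ‖z‖) ≤ w z) ∧
      ∀ z ∈ closedBall 0 1 \ ball y ρ, K * w z ≤ lap w z := by
  obtain ⟨h, hh, h0, ⟨κ, hκ, hκh⟩, hcrit⟩ := exists_unique_critical_point hy
  let D (z : EuclideanSpace ℝ (Fin N)) : ℝ :=
    ∑ i, (fderiv ℝ h z (EuclideanSpace.single i 1)) ^ 2
  have hDc : Continuous D :=
    continuous_finsetSum _ fun i _ => (contDiff_fderiv_single hh i).continuous.pow 2
  have hS : IsCompact (closedBall (0 : EuclideanSpace ℝ (Fin N)) 1 \ ball y ρ) :=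
    (isCompact_closedBall _ _).diff isOpen_ball
  obtain ⟨δ, hδ, hδD⟩ := hS.exists_forall_le' (a := 0) hDc.continuousOn fun z hz => by
    refine lt_of_le_of_ne (Finset.sum_nonneg fun i _ => sq_nonneg _) fun heq => hz.2 ?_
    have hz0 := (Finset.sum_eq_zero_iff_of_nonneg fun i _ => sq_nonneg _).1 heq.symm
    rw [hcrit z hz.1 fun i => pow_eq_zero_iff two_ne_zero |>.1 (hz0 i (Finset.mem_univ i))]
    exact mem_ball_self hρ
  obtain ⟨L, hL⟩ := hS.exists_bound_of_continuousOn (continuous_lap hh).continuousOn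
  let α : ℝ := 1 + (|L| + K) / δ
  have hα : 1 ≤ α := le_add_of_nonneg_right (by positivity)
  have hαδ : |L| + K ≤ α * δ := by
    have : α * δ = δ + (|L| + K) := by
      simp only [α]
      field_simp
    linarith
  refine ⟨fun z => Real.exp (α * h z) - 1, (Real.contDiff_exp.comp
    (contDiff_const.mul hh)).sub contDiff_const, fun z hz => by simp [h0 z hz],
    ⟨κ, hκ, fun z hz => ?_⟩, fun z hz => ?_⟩
  · have h1 := hκh z hz
    have hz1 : ‖z‖ ≤ 1 := by simpa using hz
    have h2 : 0 ≤ h z := (mul_nonneg hκ.le (by linarith)).trans h1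
    have h3 := Real.add_one_le_exp (α * h z)
    nlinarith
  · rw [lap_exp_sub_one hh]
    have h1 : K ≤ lap h z + α * D z := by
      have h2 := hL z hz
      rw [Real.norm_eq_abs] at h2
      have h3 := neg_le_of_abs_le (h2.trans (le_abs_self L))
      have h4 := mul_le_mul_of_nonneg_left (hδD z hz) (by linarith : 0 ≤ α)
      linarith
    have hexp := Real.exp_pos (α * h z)
    calc K * (Real.exp (α * h z) - 1) ≤ Real.exp (α * h z) * K := by nlinarith
      _ ≤ α * Real.exp (α * h z) * K := by
        refine mul_le_mul_of_nonneg_right ?_ hK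
        exact le_mul_of_one_le_left hexp.le hα
      _ ≤ _ := mul_le_mul_of_nonneg_left h1 (by positivity)

end Barrier

/-- Brezis–Cabré type estimate (Lemma 2.5) on the unit ball: a nonnegative-boundary
supersolution of `-Δu + a u ≥ f ≥ 0` satisfies
`u(x) ≥ C dist(x, ∂ω) ∫_{B_R(y)} f`. -/
theorem stmt_12 {N : ℕ} (hN : 2 ≤ N) (K : ℝ) (hK : 0 ≤ K)
    (y : EuclideanSpace ℝ (Fin N)) (R : ℝ) (hR : 0 < R)
    (hy : y ∈ ball (0 : EuclideanSpace ℝ (Fin N)) 1)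
    (hyR : ball y (2 * R) ⊆ ball (0 : EuclideanSpace ℝ (Fin N)) 1) :
    ∃ C : ℝ, 0 < C ∧
      ∀ a f u : EuclideanSpace ℝ (Fin N) → ℝ,
        ContinuousOn a (ball (0 : EuclideanSpace ℝ (Fin N)) 1) →
        (∀ x ∈ ball (0 : EuclideanSpace ℝ (Fin N)) 1, 0 ≤ a x ∧ a x ≤ K) →
        ContinuousOn f (ball (0 : EuclideanSpace ℝ (Fin N)) 1) →
        (∀ x ∈ ball (0 : EuclideanSpace ℝ (Fin N)) 1, 0 ≤ f x) →
        IntegrableOn f (ball (0 : EuclideanSpace ℝ (Fin N)) 1) →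
        ContDiffOn ℝ 2 u (ball (0 : EuclideanSpace ℝ (Fin N)) 1) →
        ContinuousOn u (closedBall (0 : EuclideanSpace ℝ (Fin N)) 1) →
        (∀ x ∈ sphere (0 : EuclideanSpace ℝ (Fin N)) 1, 0 ≤ u x) →
        (∀ x ∈ ball (0 : EuclideanSpace ℝ (Fin N)) 1, f x ≤ -lap u x + a x * u x) →
        ∀ x ∈ ball (0 : EuclideanSpace ℝ (Fin N)) 1,
          C * (1 - ‖x‖) * (∫ z in ball y R, f z) ≤ u x := by
  obtain ⟨w, hw, hw0, ⟨κ, hκ, hκw⟩, hwsub⟩ :=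
    exists_barrier hK (show 0 < R / 4 by positivity) hy
  obtain ⟨W, hW⟩ :=
    (isCompact_closedBall (0 : EuclideanSpace ℝ (Fin N)) 1).exists_bound_of_continuousOn
      hw.continuous.continuousOn
  let c : ℝ := 1 / 88 * (23 / 64 * R ^ 2) ^ 2 * Real.exp (-(K * (3 * R / 2) ^ 2 / 4))
  let P : ℝ := ∫ z, paraboloid (N := N) (3 * R / 2) z
  have hc : 0 < c := by positivity
  have hP : 0 ≤ P := integral_nonneg paraboloid_nonneg
  have hR4 : closedBall y (R / 4) ⊆ ball 0 1 :=
    (closedBall_subset_ball (by linarith)).trans hyR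
  refine ⟨c / ((P + 1) * (|W| + 1)) * κ, by positivity, ?_⟩
  intro a f u _ haK _ hf0 hfi hu2 hu hbd hsuper x hx
  set M := ∫ z in ball y R, f z
  have hRball : ball y R ⊆ ball 0 1 := (ball_subset_ball (by linarith)).trans hyR
  have hM : 0 ≤ M := setIntegral_nonneg measurableSet_ball fun z hz => hf0 z (hRball hz)
  have hpos : ∀ z ∈ closedBall (0 : EuclideanSpace ℝ (Fin N)) 1, 0 ≤ u z := fun z hz =>
    nonneg_of_supersolution (by lia) (isCompact_closedBall 0 1) subset_rfl isOpen_ball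
      ball_subset_closedBall hu hu2
      (fun z hz => hbd z (by rwa [closedBall_sdiff_ball] at hz))
      (fun z hz => (haK z hz).1) (fun z hz => (hf0 z hz).trans (hsuper z hz)) hz
  have hpos' : ∀ z ∈ ball (0 : EuclideanSpace ℝ (Fin N)) 1, 0 ≤ u z := fun z hz =>
    hpos z (ball_subset_closedBall hz)
  have hwpos : ∀ z ∈ closedBall (0 : EuclideanSpace ℝ (Fin N)) 1, 0 ≤ w z := fun z hz => by
    have hz1 : ‖z‖ ≤ 1 := by simpa using hz
    exact (mul_nonneg hκ.le (by linarith)).trans (hκw z hz)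
  set m : ℝ := c / ((P + 1) * (|W| + 1)) * M
  have hm : 0 ≤ m := by positivity
  have hnear : ∀ z ∈ closedBall y (R / 4), 0 ≤ u z + -m * w z := fun z hz => by
    have h1 : c * M ≤ P * u z := setIntegral_le_of_supersolutionOn hK hR hz (hu2.mono hyR)
      (fun z hz => hpos' z (hyR hz)) (fun z hz => hf0 z (hyR hz)) (hfi.mono_set hRball)
      fun z hz => (hsuper z (hyR hz)).trans (by
        have := mul_le_mul_of_nonneg_right (haK z (hyR hz)).2 (hpos' z (hyR hz))
        linarith)
    have huz := hpos' z (hR4 hz)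
    have hwz : w z ≤ |W| + 1 := by
      have := (le_abs_self _).trans (hW z (ball_subset_closedBall (hR4 hz)))
      linarith [le_abs_self W]
    have h2 : m * (|W| + 1) ≤ u z := by
      have : m * (|W| + 1) = c * M / (P + 1) := by
        simp only [m]
        field_simp
      rw [this, div_le_iff₀ (by positivity)]
      linarith
    have := mul_le_mul_of_nonneg_left hwz hm
    linarith
  have hcomp : ∀ z ∈ closedBall (0 : EuclideanSpace ℝ (Fin N)) 1 \ ball y (R / 4),
      0 ≤ u z + -m * w z := fun z hz => by
    have hmw : ContDiff ℝ 2 fun z => -m * w z := contDiff_const.mul hw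
    refine nonneg_of_supersolution (u := fun z => u z + -m * w z)
      (U := ball 0 1 \ closedBall y (R / 4)) (a := a) (by lia)
      ((isCompact_closedBall _ _).diff isOpen_ball) sdiff_subset
      (isOpen_ball.sdiff isClosed_closedBall)
      (sdiff_subset_sdiff ball_subset_closedBall ball_subset_closedBall)
      ((hu.mono sdiff_subset).add hmw.continuous.continuousOn)
      ((hu2.mono sdiff_subset).add hmw.contDiffOn) ?_ (fun p hp => (haK p hp.1).1) ?_ hz
    · rintro p ⟨⟨hp1, -⟩, hpU⟩
      by_cases hp : p ∈ closedBall y (R / 4)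
      · exact hnear p hp
      · have hps : p ∈ sphere (0 : EuclideanSpace ℝ (Fin N)) 1 := by
          rw [← closedBall_sdiff_ball]
          exact ⟨hp1, fun h => hpU ⟨h, hp⟩⟩
        simpa [hw0 p hps] using hbd p hps
    · rintro p ⟨hp1, hp2⟩
      rw [lap_add (hu2.contDiffAt (isOpen_ball.mem_nhds hp1)) hmw.contDiffAt,
        lap_const_mul _ hw.contDiffAt]
      have hpc := ball_subset_closedBall hp1
      have h1 := hwsub p ⟨hpc, fun h => hp2 (ball_subset_closedBall h)⟩
      have h2 := mul_le_mul_of_nonneg_right (haK p hp1).2 (hwpos p hpc)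
      have h3 := mul_le_mul_of_nonneg_left (h2.trans h1) hm
      linarith [hsuper p hp1, hf0 p hp1]
  have hxc := ball_subset_closedBall hx
  have hfinal : 0 ≤ u x + -m * w x := by
    by_cases hxy : x ∈ closedBall y (R / 4)
    · exact hnear x hxy
    · exact hcomp x ⟨hxc, fun h => hxy (ball_subset_closedBall h)⟩
  calc c / ((P + 1) * (|W| + 1)) * κ * (1 - ‖x‖) * M = m * (κ * (1 - ‖x‖)) := by
        simp only [m]
        ring
    _ ≤ m * w x := mul_le_mul_of_nonneg_left (hκw x hxc) hm
    _ ≤ u x := by linarith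
end
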